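/- Let (M, 𝒳) ⊨ GB and let Γ ∈ 𝒳 be a class well-order ≥ ω^ω, and suppose (M, 𝒳) ⊨ ETR_{Γ·ω}. Then there is 𝒴 ⊆ 𝒳, coded by a single class in 𝒳, such that (M, 𝒴) ⊨ GB + ETR_Γ but (M, 𝒴) ⊭ ETR_{Γ·ω}. If (M, 𝒳) moreover satisfies Global Choice, then 𝒴 can be chosen so that (M, 𝒴) also satisfies Global Choice. -/

import Mathlib

/- A self-contained formalization framework for two-sorted second-order set theories
(Gödel–Bernays `GB`, Kelley–Morse `KM`, Elementary Transfinite Recursion `ETR`, ...).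

A model of second-order set theory is given by a carrier type `α`, a domain `D : Set α`
of its sets, a membership relation `E : α → α → Prop`, and a collection
`𝒳 : Set (Set α)` of classes (extensional classes are identified with subsets of the
first-order part). Schemas are formalized via a deep embedding `Fml` of the two-sorted
language: lower-case (set) variables and upper-case (class) variables, both indexed by ℕ. -/

namespace SOST

/-- Formulas of the two-sorted language of second-order set theory.
`memSS i j` is `xᵢ ∈ xⱼ`, `memSC i j` is `xᵢ ∈ Xⱼ`, `eqS i j` is `xᵢ = xⱼ`,
`allS` quantifies a set variable, `allC` a class variable. -/
inductive Fml : Type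
  | memSS : ℕ → ℕ → Fml
  | memSC : ℕ → ℕ → Fml
  | eqS : ℕ → ℕ → Fml
  | fal : Fml
  | imp : Fml → Fml → Fml
  | allS : ℕ → Fml → Fml
  | allC : ℕ → Fml → Fml
deriving DecidableEq

/-- Negation, defined from implication and falsity. -/
def Fml.neg (φ : Fml) : Fml := φ.imp .fal

variable {α : Type*}

/-- Tarskian satisfaction for the two-sorted language, over the structure with
first-order domain `D`, membership `E` and collection of classes `𝒳`.
Set quantifiers range over `D`; class quantifiers range over `𝒳`.
`s` assigns set variables, `c` assigns class variables. -/
def Sat (D : Set α) (E : α → α → Prop) (𝒳 : Set (Set α)) :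
    Fml → (ℕ → α) → (ℕ → Set α) → Prop
  | .memSS i j, s, _ => E (s i) (s j)
  | .memSC i j, s, c => s i ∈ c j
  | .eqS i j, s, _ => s i = s j
  | .fal, _, _ => False
  | .imp φ ψ, s, c => Sat D E 𝒳 φ s c → Sat D E 𝒳 ψ s c
  | .allS i φ, s, c => ∀ x ∈ D, Sat D E 𝒳 φ (Function.update s i x) c
  | .allC i φ, s, c => ∀ X ∈ 𝒳, Sat D E 𝒳 φ s (Function.update c i X)

/-- A formula is *elementary* (first-order) if it has no class quantifiers
(class variables may still occur freely, as parameters). -/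
def Fml.IsElementary : Fml → Prop
  | .memSS _ _ => True
  | .memSC _ _ => True
  | .eqS _ _ => True
  | .fal => True
  | .imp φ ψ => φ.IsElementary ∧ ψ.IsElementary
  | .allS _ φ => φ.IsElementary
  | .allC _ _ => False

/-- A formula is *pure* if it mentions no class variables at all
(it is a formula of the first-order language of set theory). -/
def Fml.IsPure : Fml → Prop
  | .memSS _ _ => True
  | .memSC _ _ => False
  | .eqS _ _ => True
  | .fal => True
  | .imp φ ψ => φ.IsPure ∧ ψ.IsPure
  | .allS _ φ => φ.IsPure
  | .allC _ _ => False

/-- Π¹₁ formulas: a single universal class quantifier followed by an elementary formula. -/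
def Fml.IsPi11 (φ : Fml) : Prop :=
  ∃ (i : ℕ) (ψ : Fml), ψ.IsElementary ∧ φ = Fml.allC i ψ

/-- Σ¹₁ formulas: an existential class quantifier (coded as `¬∀X¬`) followed by an
elementary formula. -/
def Fml.IsSigma11 (φ : Fml) : Prop :=
  ∃ (i : ℕ) (ψ : Fml), ψ.IsElementary ∧ φ = (Fml.allC i ψ.neg).neg

/-- `x` is internally transitive: members of members (within `D`) are members. -/
def IsTransIn (D : Set α) (E : α → α → Prop) (x : α) : Prop :=
  ∀ y ∈ D, E y x → ∀ z ∈ D, E z y → E z x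

/-- `x` is internally a (von Neumann) ordinal: a transitive set of transitive sets. -/
def IsOrdIn (D : Set α) (E : α → α → Prop) (x : α) : Prop :=
  x ∈ D ∧ IsTransIn D E x ∧ ∀ y ∈ D, E y x → IsTransIn D E y

/-- `p` is internally the Kuratowski ordered pair `⟨a, b⟩ = {{a}, {a, b}}`. -/
def IsKPair (D : Set α) (E : α → α → Prop) (p a b : α) : Prop :=
  p ∈ D ∧ a ∈ D ∧ b ∈ D ∧
    ∀ z ∈ D, (E z p ↔
      ((∀ w ∈ D, E w z ↔ w = a) ∨ (∀ w ∈ D, E w z ↔ (w = a ∨ w = b))))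

/-- For a class `R` of (internal) ordered pairs, `PairIn D E R a b` says
that the pair `⟨a, b⟩` belongs to `R`, i.e. `a R b`. -/
def PairIn (D : Set α) (E : α → α → Prop) (R : Set α) (a b : α) : Prop :=
  ∃ p ∈ R, IsKPair D E p a b

/-- `R` is a class of (internal) ordered pairs, i.e. a class binary relation. -/
def IsClassRel (D : Set α) (E : α → α → Prop) (R : Set α) : Prop :=
  ∀ z ∈ R, ∃ a b, a ∈ D ∧ b ∈ D ∧ IsKPair D E z a b

/-- The field of a class relation `R`. -/
def relFld (D : Set α) (E : α → α → Prop) (R : Set α) : Set α :=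
  {a | a ∈ D ∧ ∃ b, PairIn D E R a b ∨ PairIn D E R b a}

/-- The internal (first-order) characterization of well-foundedness for a class
relation `R` over a model of `GB`: every nonempty *set* all of whose members lie
in the field of `R` has an `R`-minimal element. -/
def IntWF (D : Set α) (E : α → α → Prop) (R : Set α) : Prop :=
  ∀ d ∈ D, (∃ z ∈ D, E z d) → (∀ z ∈ D, E z d → z ∈ relFld D E R) →
    ∃ m ∈ D, E m d ∧ ∀ z ∈ D, E z d → ¬ PairIn D E R z m

/-- The first-order `ZF` axioms, with the Separation and Replacement schemas ranging over
pure formulas of the language of set theory (with set parameters). -/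
structure ZFModel (D : Set α) (E : α → α → Prop) : Prop where
  nonempty : ∃ x, x ∈ D
  exten : ∀ x ∈ D, ∀ y ∈ D, (∀ z ∈ D, E z x ↔ E z y) → x = y
  pairing : ∀ x ∈ D, ∀ y ∈ D, ∃ p ∈ D, ∀ z ∈ D, E z p ↔ (z = x ∨ z = y)
  union : ∀ x ∈ D, ∃ u ∈ D, ∀ z ∈ D, E z u ↔ ∃ w ∈ D, E w x ∧ E z w
  power : ∀ x ∈ D, ∃ p ∈ D, ∀ z ∈ D, E z p ↔ ∀ w ∈ D, E w z → E w x
  infinity : ∃ I ∈ D, (∃ e ∈ D, E e I ∧ ∀ z ∈ D, ¬ E z e) ∧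
    ∀ x ∈ D, E x I → ∃ s ∈ D, E s I ∧ ∀ z ∈ D, (E z s ↔ (E z x ∨ z = x))
  foundation : ∀ x ∈ D, (∃ z ∈ D, E z x) → ∃ m ∈ D, E m x ∧ ∀ z ∈ D, E z m → ¬ E z x
  separation : ∀ φ : Fml, φ.IsPure → ∀ s : ℕ → α, (∀ n, s n ∈ D) → ∀ a ∈ D,
    ∃ b ∈ D, ∀ z ∈ D, E z b ↔
      (E z a ∧ Sat D E ∅ φ (Function.update s 0 z) (fun _ => (∅ : Set α)))
  replacement : ∀ φ : Fml, φ.IsPure → ∀ s : ℕ → α, (∀ n, s n ∈ D) →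
    (∀ x ∈ D, ∀ y ∈ D, ∀ y' ∈ D,
      Sat D E ∅ φ (Function.update (Function.update s 0 x) 1 y) (fun _ => (∅ : Set α)) →
      Sat D E ∅ φ (Function.update (Function.update s 0 x) 1 y') (fun _ => (∅ : Set α)) →
      y = y') →
    ∀ a ∈ D, ∃ b ∈ D, ∀ y ∈ D, E y b ↔ ∃ x ∈ D, E x a ∧
      Sat D E ∅ φ (Function.update (Function.update s 0 x) 1 y) (fun _ => (∅ : Set α))

/-- The Axiom of Choice for sets (choice sets for disjoint families of nonempty sets). -/
def SatAC (D : Set α) (E : α → α → Prop) : Prop :=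
  ∀ x ∈ D, (∀ y ∈ D, E y x → ∃ z ∈ D, E z y) →
    (∀ y ∈ D, ∀ y' ∈ D, E y x → E y' x → (∃ z ∈ D, E z y ∧ E z y') → y = y') →
    ∃ c ∈ D, ∀ y ∈ D, E y x →
      ∃ z ∈ D, E z y ∧ E z c ∧ ∀ w ∈ D, E w y → E w c → w = z

/-- Gödel–Bernays set theory `GB`: ZF for the sets, extensionality for classes
(automatic here since classes are subsets of the first-order part), Class Replacement,
and Elementary Comprehension (for formulas without class quantifiers, allowing
set and class parameters). -/
structure GBModel (D : Set α) (E : α → α → Prop) (𝒳 : Set (Set α)) : Prop where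
  classes_sub : ∀ X ∈ 𝒳, X ⊆ D
  zf : ZFModel D E
  classRepl : ∀ F ∈ 𝒳,
    (∀ x y y', PairIn D E F x y → PairIn D E F x y' → y = y') →
    ∀ a ∈ D, ∃ b ∈ D, ∀ y ∈ D, E y b ↔ ∃ x ∈ D, E x a ∧ PairIn D E F x y
  elemComp : ∀ φ : Fml, φ.IsElementary → ∀ s : ℕ → α, (∀ n, s n ∈ D) →
    ∀ c : ℕ → Set α, (∀ n, c n ∈ 𝒳) →
    ∃ X ∈ 𝒳, ∀ x ∈ D, (x ∈ X ↔ Sat D E 𝒳 φ (Function.update s 0 x) c)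

/-- The Comprehension schema restricted to formulas satisfying `P`
(with set parameters and class parameters from `𝒳`). -/
def Comp (D : Set α) (E : α → α → Prop) (𝒳 : Set (Set α)) (P : Fml → Prop) : Prop :=
  ∀ φ : Fml, P φ → ∀ s : ℕ → α, (∀ n, s n ∈ D) →
    ∀ c : ℕ → Set α, (∀ n, c n ∈ 𝒳) →
    ∃ X ∈ 𝒳, ∀ x ∈ D, (x ∈ X ↔ Sat D E 𝒳 φ (Function.update s 0 x) c)

/-- Kelley–Morse set theory `KM`: `GB` together with full Comprehension for all
second-order formulas. -/
def KMModel (D : Set α) (E : α → α → Prop) (𝒳 : Set (Set α)) : Prop :=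
  GBModel D E 𝒳 ∧ Comp D E 𝒳 (fun _ => True)

/-- Π¹₁-Comprehension. -/
def Pi11CA (D : Set α) (E : α → α → Prop) (𝒳 : Set (Set α)) : Prop :=
  Comp D E 𝒳 Fml.IsPi11

/-- Δ¹₁-Comprehension: if a property of sets is equivalently defined by a Π¹₁ and a
Σ¹₁ formula (with parameters), then the corresponding class exists. -/
def Delta11CA (D : Set α) (E : α → α → Prop) (𝒳 : Set (Set α)) : Prop :=
  ∀ φ ψ : Fml, φ.IsPi11 → ψ.IsSigma11 →
    ∀ s : ℕ → α, (∀ n, s n ∈ D) → ∀ c : ℕ → Set α, (∀ n, c n ∈ 𝒳) →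
    (∀ x ∈ D, Sat D E 𝒳 φ (Function.update s 0 x) c ↔
      Sat D E 𝒳 ψ (Function.update s 0 x) c) →
    ∃ X ∈ 𝒳, ∀ x ∈ D, (x ∈ X ↔ Sat D E 𝒳 φ (Function.update s 0 x) c)

/-- Global Choice: there is a class bijection between the universe `V` and the
class `Ord` of all ordinals. -/
def GlobalChoice (D : Set α) (E : α → α → Prop) (𝒳 : Set (Set α)) : Prop :=
  ∃ F ∈ 𝒳, IsClassRel D E F ∧
    (∀ x y y', PairIn D E F x y → PairIn D E F x y' → y = y') ∧
    (∀ x x' y, PairIn D E F x y → PairIn D E F x' y → x = x') ∧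
    (∀ x ∈ D, ∃ y, PairIn D E F x y ∧ IsOrdIn D E y) ∧
    (∀ y, IsOrdIn D E y → ∃ x ∈ D, PairIn D E F x y)

/-- The `i`-th slice `(C)_i = {y : ⟨i, y⟩ ∈ C}` of a class `C`. -/
def slice (D : Set α) (E : α → α → Prop) (C : Set α) (i : α) : Set α :=
  {y | y ∈ D ∧ PairIn D E C i y}

/-- The restriction `S ↾ r` of a solution class `S` (a class of pairs) to indices
strictly `lt`-below `r`. -/
def sliceRestrict (D : Set α) (E : α → α → Prop) (S : Set α)
    (lt : α → α → Prop) (r : α) : Set α :=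
  {z | z ∈ S ∧ ∃ r' x, lt r' r ∧ IsKPair D E z r' x}

/-- Elementary transfinite recursion along the (external presentation of a) class
relation with field `F` and (transitive) order relation `lt`: for every elementary
formula `φ(x, Y, A)` with class parameter `A ∈ 𝒳` (and set parameters) there is a
solution class `S ∈ 𝒳`, i.e. a class of pairs concentrated on `F` such that for each
`r ∈ F` the slice `S_r` is `{x : φ(x, S ↾ r, A)}`. Class variable `0` is interpreted
by the partial solution `S ↾ r` and the remaining class variables by the parameter. -/
def ETRFor (D : Set α) (E : α → α → Prop) (𝒳 : Set (Set α))
    (F : Set α) (lt : α → α → Prop) : Prop :=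
  ∀ φ : Fml, φ.IsElementary → ∀ A ∈ 𝒳, ∀ s : ℕ → α, (∀ n, s n ∈ D) →
    ∃ S ∈ 𝒳, (∀ z ∈ S, ∃ r x, r ∈ F ∧ x ∈ D ∧ IsKPair D E z r x) ∧
      ∀ r ∈ F, ∀ x ∈ D,
        (PairIn D E S r x ↔
          Sat D E 𝒳 φ (Function.update s 0 x)
            (fun n => if n = 0 then sliceRestrict D E S lt r else A))

/-- The principle `ETR` of Elementary Transfinite Recursion: every elementary recursion
along a class relation in `𝒳` which the model believes to be well-founded has a
solution in `𝒳`. -/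
def ETR (D : Set α) (E : α → α → Prop) (𝒳 : Set (Set α)) : Prop :=
  ∀ R ∈ 𝒳, IsClassRel D E R → IntWF D E R →
    ETRFor D E 𝒳 (relFld D E R) (Relation.TransGen (PairIn D E R))

/-- `x` is internally a natural number: an ordinal all of whose `≤`-elements are zero
or a successor. -/
def IsNatIn (D : Set α) (E : α → α → Prop) (x : α) : Prop :=
  IsOrdIn D E x ∧ ∀ y ∈ D, (E y x ∨ y = x) →
    ((∀ z ∈ D, ¬ E z y) ∨ ∃ z ∈ D, E z y ∧ ∀ w ∈ D, (E w y ↔ (E w z ∨ w = z)))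

/-- The class `Ord` of internal ordinals. -/
def ordsOf (D : Set α) (E : α → α → Prop) : Set α := {x | IsOrdIn D E x}

/-- The class `ω` of internal natural numbers. -/
def natsOf (D : Set α) (E : α → α → Prop) : Set α := {x | IsNatIn D E x}

/-- `ETR_ω`: elementary transfinite recursion along the well-order `ω`. -/
def ETRomega (D : Set α) (E : α → α → Prop) (𝒳 : Set (Set α)) : Prop :=
  ETRFor D E 𝒳 (natsOf D E) E

/-- `ETR_Ord`: elementary transfinite recursion along the well-order `Ord`. -/
def ETROrd (D : Set α) (E : α → α → Prop) (𝒳 : Set (Set α)) : Prop :=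
  ETRFor D E 𝒳 (ordsOf D E) E

/-- `lt` is internally a well-order of the class `F`: irreflexive, transitive, total,
and every nonempty set of elements of `F` has an `lt`-minimal element. -/
def IntWORel (D : Set α) (E : α → α → Prop) (F : Set α) (lt : α → α → Prop) : Prop :=
  (∀ a ∈ F, ¬ lt a a) ∧
  (∀ a ∈ F, ∀ b ∈ F, ∀ c ∈ F, lt a b → lt b c → lt a c) ∧
  (∀ a ∈ F, ∀ b ∈ F, a = b ∨ lt a b ∨ lt b a) ∧
  (∀ d ∈ D, (∃ z ∈ D, E z d) → (∀ z ∈ D, E z d → z ∈ F) →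
    ∃ m ∈ D, E m d ∧ ∀ z ∈ D, E z d → ¬ lt z m)

/-- `W ∈ 𝒳`-style class well-order: a class relation which is internally a well-order
of its field. -/
def IsClassWO (D : Set α) (E : α → α → Prop) (W : Set α) : Prop :=
  IsClassRel D E W ∧ IntWORel D E (relFld D E W) (PairIn D E W)

/-- Strict lexicographic order on `Fin n → ℕ`, most significant coordinate first;
the order type of `(Fin n → ℕ, lex)` is `ω^n`. -/
def FinLexLt {n : ℕ} (v w : Fin n → ℕ) : Prop :=
  ∃ i : Fin n, (∀ j : Fin n, j < i → v j = w j) ∧ v i < w i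

/-- The well-order `(F, lt)` has order type at least `ω^ω`: for each `n` there is an
order embedding of `ω^n` into it. -/
def GeOmegaPowOmega (F : Set α) (lt : α → α → Prop) : Prop :=
  ∀ n : ℕ, ∃ f : (Fin n → ℕ) → α, (∀ v, f v ∈ F) ∧
    ∀ v w, FinLexLt v w → lt (f v) (f w)

/-- The field of the well-order `Γ · ω` (`ω` copies of `Γ`, for `Γ` with field `F`):
internal pairs `⟨n, g⟩` with `n` an internal natural number and `g ∈ F`. -/
def timesOmegaFld (D : Set α) (E : α → α → Prop) (F : Set α) : Set α :=
  {p | ∃ n g, IsNatIn D E n ∧ g ∈ F ∧ IsKPair D E p n g}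

/-- The ordering of `Γ · ω`: pairs `⟨n, g⟩` ordered lexicographically with the
natural-number coordinate most significant. -/
def timesOmegaLt (D : Set α) (E : α → α → Prop) (F : Set α)
    (lt : α → α → Prop) : α → α → Prop :=
  fun p q => ∃ n g m h, IsKPair D E p n g ∧ IsKPair D E q m h ∧
    IsNatIn D E n ∧ IsNatIn D E m ∧ g ∈ F ∧ h ∈ F ∧
    (E n m ∨ (n = m ∧ lt g h))

/-- The classes of `(D, E)` definable by pure first-order formulas with set parameters:
`Def(M)`. -/
def Def0 (D : Set α) (E : α → α → Prop) : Set (Set α) :=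
  {X | ∃ φ : Fml, φ.IsPure ∧ ∃ s : ℕ → α, (∀ n, s n ∈ D) ∧
    X = {x | x ∈ D ∧ Sat D E ∅ φ (Function.update s 0 x) (fun _ => (∅ : Set α))}}

/-- The classes of `(D, E)` definable by elementary formulas with set parameters and the
class parameter `A`: `Def(M; A)`. -/
def DefFrom (D : Set α) (E : α → α → Prop) (A : Set α) : Set (Set α) :=
  {X | ∃ φ : Fml, φ.IsElementary ∧ ∃ s : ℕ → α, (∀ n, s n ∈ D) ∧
    X = {x | x ∈ D ∧ Sat D E {A} φ (Function.update s 0 x) (fun _ => A)}}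

/-- `W` is a global well-order of the model: a class strict linear order of `D` which is
set-like and under which every nonempty set has a least element. -/
def IsGWO (D : Set α) (E : α → α → Prop) (W : Set α) : Prop :=
  IsClassRel D E W ∧
  (∀ a ∈ D, ¬ PairIn D E W a a) ∧
  (∀ a ∈ D, ∀ b ∈ D, ∀ c ∈ D, PairIn D E W a b → PairIn D E W b c → PairIn D E W a c) ∧
  (∀ a ∈ D, ∀ b ∈ D, a = b ∨ PairIn D E W a b ∨ PairIn D E W b a) ∧
  (∀ d ∈ D, (∃ z ∈ D, E z d) →
    ∃ m ∈ D, E m d ∧ ∀ z ∈ D, E z d → ¬ PairIn D E W z m) ∧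
  (∀ a ∈ D, ∃ d ∈ D, ∀ b ∈ D, PairIn D E W b a → E b d)

/-- `(M, 𝒳)` is a transitive model of `GB`: `M` is a transitive set, the membership
relation is the true `∈`, and the classes `𝒳` are subsets of `M`. -/
def TransGB (M : ZFSet) (𝒳 : Set (Set ZFSet)) : Prop :=
  M.IsTransitive ∧ GBModel M.toSet (· ∈ ·) 𝒳

/-- A class relation `R` on a transitive model is *truly* well-founded when the
corresponding external relation is well-founded. -/
def TrulyWF (M : ZFSet) (R : Set ZFSet) : Prop :=
  WellFounded (fun a b : ZFSet => PairIn M.toSet (· ∈ ·) R a b)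

/-- `(M, 𝒳)` is a β-model: every class relation in `𝒳` which the model believes to be
well-founded is truly well-founded. -/
def IsBeta (M : ZFSet) (𝒳 : Set (Set ZFSet)) : Prop :=
  ∀ R ∈ 𝒳, IsClassRel M.toSet (· ∈ ·) R → IntWF M.toSet (· ∈ ·) R → TrulyWF M R

end SOST

namespace SOST

/-- A Gödel code for formulas. -/
def Fml.code : Fml → ℕ
  | .memSS i j => Nat.pair 0 (Nat.pair i j)
  | .memSC i j => Nat.pair 1 (Nat.pair i j)
  | .eqS i j => Nat.pair 2 (Nat.pair i j)
  | .fal => Nat.pair 3 0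
  | .imp φ ψ => Nat.pair 4 (Nat.pair φ.code ψ.code)
  | .allS i φ => Nat.pair 5 (Nat.pair i φ.code)
  | .allC i φ => Nat.pair 6 (Nat.pair i φ.code)

/-- Satisfaction for a second-order theory given as a set `T ⊆ ω` of codes of
(two-sorted) formulas: every coded formula holds under all assignments into the model. -/
def SatSOTheory (D : Set α) (E : α → α → Prop) (𝒳 : Set (Set α)) (T : Set ℕ) : Prop :=
  ∀ φ : Fml, φ.code ∈ T → ∀ s : ℕ → α, (∀ n, s n ∈ D) →
    ∀ c : ℕ → Set α, (∀ n, c n ∈ 𝒳) → Sat D E 𝒳 φ s c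

/-- Satisfaction for a first-order theory given as a set of pure formulas. -/
def SatTheory (D : Set α) (E : α → α → Prop) (T : Set Fml) : Prop :=
  ∀ φ ∈ T, ∀ s : ℕ → α, (∀ n, s n ∈ D) →
    Sat D E ∅ φ s (fun _ => (∅ : Set α))

/-- The internal von Neumann numeral for `k`. -/
def Numeral (D : Set α) (E : α → α → Prop) : ℕ → α → Prop
  | 0, x => x ∈ D ∧ ∀ z ∈ D, ¬ E z x
  | (n + 1), x => x ∈ D ∧ ∃ y ∈ D, Numeral D E n y ∧ ∀ z ∈ D, (E z x ↔ (E z y ∨ z = y))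

/-- The external von Neumann numeral, as a `ZFSet`. -/
def zfNumeral : ℕ → ZFSet
  | 0 => ∅
  | (n + 1) => insert (zfNumeral n) (zfNumeral n)

/-- The real coded by a set `T ⊆ ω` of natural numbers, as a `ZFSet`. -/
def zfCode (T : Set ℕ) : ZFSet :=
  ZFSet.sep (fun z => ∃ k ∈ T, z = zfNumeral k) ZFSet.omega

instance : WellFoundedRelation ZFSet := ⟨_, ZFSet.mem_wf⟩

/-- The subsets of the transitive set `P` (given as a `Set ZFSet`) which are definable
over the structure `(P, ∈)` by a pure first-order formula with parameters from `P`. -/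
def DefSetsOver (P : Set ZFSet) : Set ZFSet :=
  {X | ∃ φ : Fml, φ.IsPure ∧ ∃ s : ℕ → ZFSet, (∀ n, s n ∈ P) ∧
    ∀ z : ZFSet, z ∈ X ↔
      (z ∈ P ∧ Sat P (· ∈ ·) ∅ φ (Function.update s 0 z) (fun _ => (∅ : Set ZFSet)))}

/-- `a` is a genuine von Neumann ordinal (a transitive set of transitive sets). -/
def IsVonNeumann (a : ZFSet) : Prop :=
  a.IsTransitive ∧ ∀ b ∈ a.toSet, b.IsTransitive

/-- The stage `L_a` of the constructible hierarchy, indexed by von Neumann ordinals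
(each stage consists of the subsets definable over the union of the earlier stages). -/
noncomputable def LStage (a : ZFSet) : Set ZFSet :=
  DefSetsOver (⋃ b : {b : ZFSet // b ∈ a}, LStage b.1)
termination_by a
decreasing_by exact b.2

/-- The constructible universe computed inside the transitive set `M`:
the union of the stages `L_α` for `α` an ordinal of `M`. -/
def ConstructibleOf (M : ZFSet) : Set ZFSet :=
  ⋃ a ∈ {a : ZFSet | a ∈ M ∧ IsVonNeumann a}, LStage a

/-- `L^M`, as a transitive subset of `M` (a `ZFSet`). -/
noncomputable def LM (M : ZFSet) : ZFSet :=
  ZFSet.sep (fun x => x ∈ ConstructibleOf M) M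

/-- The collection of all subclasses of (the transitive set) `N` which are amenable
to `N`: `X ∩ a ∈ N` for every `a ∈ N`. -/
def AmenablesOf (N : ZFSet) : Set (Set ZFSet) :=
  {X | X ⊆ N.toSet ∧ ∀ a ∈ N.toSet, ZFSet.sep (fun z => z ∈ X) a ∈ N.toSet}

/-- The binary class relation named by the parameter-free pure formula `θ` (with free
set variables `0` and `1`), evaluated in the model `(D, E)`. -/
def NameRel (θ : Fml) (D : Set α) (E : α → α → Prop) (x y : α) : Prop :=
  x ∈ D ∧ y ∈ D ∧ ∀ s : ℕ → α, (∀ n, s n ∈ D) →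
    Sat D E ∅ θ (Function.update (Function.update s 0 x) 1 y) (fun _ => (∅ : Set α))

/-- The field of the class relation named by `θ` in the model `(D, E)`. -/
def NameFld (θ : Fml) (D : Set α) (E : α → α → Prop) : Set α :=
  {x | ∃ y, NameRel θ D E x y ∨ NameRel θ D E y x}

/-- The set named by the parameter-free pure formula `θ` (with free set variable `0`),
evaluated in the model `(D, E)`. -/
def NameSet (θ : Fml) (D : Set α) (E : α → α → Prop) (x : α) : Prop :=
  x ∈ D ∧ ∀ s : ℕ → α, (∀ n, s n ∈ D) →
    Sat D E ∅ θ (Function.update s 0 x) (fun _ => (∅ : Set α))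

/-- `𝒴` is coded in the model by the single class `C`: the members of `𝒴` are exactly
the classes definable (by elementary formulas, with set parameters) from finitely many
slices of `C`. -/
def CodedBy (D : Set α) (E : α → α → Prop) (C : Set α) (𝒴 : Set (Set α)) : Prop :=
  ∀ X : Set α, X ∈ 𝒴 ↔
    ∃ φ : Fml, φ.IsElementary ∧ ∃ s : ℕ → α, (∀ n, s n ∈ D) ∧
      ∃ g : ℕ → α, (∀ n, g n ∈ D) ∧
      X = {x | x ∈ D ∧ Sat D E 𝒴 φ (Function.update s 0 x)
        (fun n => slice D E C (g n))}

end SOST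

namespace SOST

/-- Δ₀ (bounded) formulas of the first-order language of set theory: all quantifiers
appear in the bounded pattern `∀ xᵢ (xᵢ ∈ xⱼ → …)`. -/
def Fml.IsDelta0 : Fml → Prop
  | .memSS _ _ => True
  | .memSC _ _ => False
  | .eqS _ _ => True
  | .fal => True
  | .imp φ ψ => φ.IsDelta0 ∧ ψ.IsDelta0
  | .allS i (.imp (.memSS i' j) φ) => i = i' ∧ i ≠ j ∧ φ.IsDelta0
  | .allS _ _ => False
  | .allC _ _ => False

/-- Π₁ formulas: a block of universal set quantifiers followed by a Δ₀ formula. -/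
def Fml.IsPi1 : Fml → Prop
  | .allS _ φ => φ.IsPi1
  | φ => φ.IsDelta0

/-- Kripke–Platek set theory `KP` over the structure with domain `D` and membership `E`:
Extensionality, Pairing, Union, Δ₀-Separation, Δ₀-Collection, and Π₁-Foundation. -/
structure KPModel (D : Set α) (E : α → α → Prop) : Prop where
  exten : ∀ x ∈ D, ∀ y ∈ D, (∀ z ∈ D, E z x ↔ E z y) → x = y
  pairing : ∀ x ∈ D, ∀ y ∈ D, ∃ p ∈ D, ∀ z ∈ D, E z p ↔ (z = x ∨ z = y)
  union : ∀ x ∈ D, ∃ u ∈ D, ∀ z ∈ D, E z u ↔ ∃ w ∈ D, E w x ∧ E z w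
  delta0Sep : ∀ φ : Fml, φ.IsDelta0 → ∀ s : ℕ → α, (∀ n, s n ∈ D) → ∀ a ∈ D,
    ∃ b ∈ D, ∀ z ∈ D, E z b ↔
      (E z a ∧ Sat D E ∅ φ (Function.update s 0 z) (fun _ => (∅ : Set α)))
  delta0Coll : ∀ φ : Fml, φ.IsDelta0 → ∀ s : ℕ → α, (∀ n, s n ∈ D) → ∀ a ∈ D,
    (∀ x ∈ D, E x a → ∃ y ∈ D,
      Sat D E ∅ φ (Function.update (Function.update s 0 x) 1 y) (fun _ => (∅ : Set α))) →
    ∃ b ∈ D, ∀ x ∈ D, E x a → ∃ y ∈ D, E y b ∧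
      Sat D E ∅ φ (Function.update (Function.update s 0 x) 1 y) (fun _ => (∅ : Set α))
  pi1Foundation : ∀ φ : Fml, φ.IsPi1 → ∀ s : ℕ → α, (∀ n, s n ∈ D) →
    (∃ x ∈ D, Sat D E ∅ φ (Function.update s 0 x) (fun _ => (∅ : Set α))) →
    ∃ x ∈ D, Sat D E ∅ φ (Function.update s 0 x) (fun _ => (∅ : Set α)) ∧
      ∀ y ∈ D, E y x → ¬ Sat D E ∅ φ (Function.update s 0 y) (fun _ => (∅ : Set α))

/-- `m` is the maximum element of the class relation `N`: every other element of the
field lies below `m` in the transitive closure of `N`. -/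
def IsMaxOf (D : Set α) (E : α → α → Prop) (N : Set α) (m : α) : Prop :=
  m ∈ relFld D E N ∧
    ∀ a ∈ relFld D E N, a ≠ m → Relation.TransGen (PairIn D E N) a m

/-- A *membership code*: a well-founded (in the sense of the model), extensional class
binary relation with a maximum element. -/
def IsMemCode (D : Set α) (E : α → α → Prop) (N : Set α) : Prop :=
  IsClassRel D E N ∧ IntWF D E N ∧
    (∀ a ∈ relFld D E N, ∀ b ∈ relFld D E N,
      (∀ c, PairIn D E N c a ↔ PairIn D E N c b) → a = b) ∧
    ∃ m, IsMaxOf D E N m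

/-- The membership code `(N, m)` codes a transitive set: predecessors of predecessors
of the maximum element are predecessors of the maximum element. -/
def CodesTransitiveSet (D : Set α) (E : α → α → Prop) (N : Set α) (m : α) : Prop :=
  ∀ a b, PairIn D E N a b → PairIn D E N b m → PairIn D E N a m

/-- The set coded by `(N, m)` contains (an isomorphic copy of) the class `V` of all
sets as an element: there are `v` below `m` and a class isomorphism `I ∈ 𝒳` between
`(D, E)` and the predecessors of `v` in `N`. -/
def ContainsUniverse (D : Set α) (E : α → α → Prop) (𝒳 : Set (Set α))
    (N : Set α) (m : α) : Prop :=
  ∃ v, PairIn D E N v m ∧ ∃ I ∈ 𝒳,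
    (∀ z ∈ I, ∃ x a, x ∈ D ∧ IsKPair D E z x a) ∧
    (∀ x a a', PairIn D E I x a → PairIn D E I x a' → a = a') ∧
    (∀ x x' a, PairIn D E I x a → PairIn D E I x' a → x = x') ∧
    (∀ x ∈ D, ∃ a, PairIn D E I x a ∧ PairIn D E N a v) ∧
    (∀ a, PairIn D E N a v → ∃ x ∈ D, PairIn D E I x a) ∧
    (∀ x y a b, PairIn D E I x a → PairIn D E I y b → (E x y ↔ PairIn D E N a b))

/-- `N` is a membership code for (a transitive model of) `Hyp(V)`-style structure:
it codes a transitive model of `KP` containing the universe as an element. -/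
def IsHypVCode (D : Set α) (E : α → α → Prop) (𝒳 : Set (Set α)) (N : Set α) : Prop :=
  IsMemCode D E N ∧ ∃ m, IsMaxOf D E N m ∧ CodesTransitiveSet D E N m ∧
    KPModel {a | PairIn D E N a m} (PairIn D E N) ∧
    ContainsUniverse D E 𝒳 N m

/-- `J` is (the graph of) an isomorphism of the membership code `N₀` onto an initial
(downward closed) part of the membership code `N`. -/
def InitEmbed (D : Set α) (E : α → α → Prop) (N₀ N J : Set α) : Prop :=
  (∀ z ∈ J, ∃ a b, IsKPair D E z a b) ∧
  (∀ a b b', PairIn D E J a b → PairIn D E J a b' → b = b') ∧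
  (∀ a a' b, PairIn D E J a b → PairIn D E J a' b → a = a') ∧
  (∀ a b, PairIn D E J a b → a ∈ relFld D E N₀ ∧ b ∈ relFld D E N) ∧
  (∀ a ∈ relFld D E N₀, ∃ b, PairIn D E J a b) ∧
  (∀ a a' b b', PairIn D E J a b → PairIn D E J a' b' →
    (PairIn D E N₀ a a' ↔ PairIn D E N b b')) ∧
  (∀ a b c, PairIn D E J a b → PairIn D E N c b →
    ∃ a', PairIn D E N₀ a' a ∧ PairIn D E J a' c)

/-! ### Kripke–Platek set theory with urelements, and `Hyp(M)` -/

/-- Formulas of the language of `KPU` over a structure `M`: membership `mem`, equality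
`eq`, the urelement predicate `urel`, and the membership relation `memU` of `M` on the
urelements. -/
inductive UFml : Type
  | mem : ℕ → ℕ → UFml
  | eq : ℕ → ℕ → UFml
  | urel : ℕ → UFml
  | memU : ℕ → ℕ → UFml
  | fal : UFml
  | imp : UFml → UFml → UFml
  | all : ℕ → UFml → UFml

variable {β : Type*}

/-- Satisfaction for `UFml` in a structure `(β, u, Eb, EU)`: `u` is the urelement
predicate, `Eb` the set membership and `EU` the membership relation of `M` on the
urelements. -/
def USat (u : β → Prop) (Eb EU : β → β → Prop) : UFml → (ℕ → β) → Prop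
  | .mem i j, s => Eb (s i) (s j)
  | .eq i j, s => s i = s j
  | .urel i, s => u (s i)
  | .memU i j, s => EU (s i) (s j)
  | .fal, _ => False
  | .imp φ ψ, s => USat u Eb EU φ s → USat u Eb EU ψ s
  | .all i φ, s => ∀ x : β, USat u Eb EU φ (Function.update s i x)

/-- Δ₀ formulas of the language of `KPU`. -/
def UFml.IsDelta0 : UFml → Prop
  | .mem _ _ => True
  | .eq _ _ => True
  | .urel _ => True
  | .memU _ _ => True
  | .fal => True
  | .imp φ ψ => φ.IsDelta0 ∧ ψ.IsDelta0
  | .all i (.imp (.mem i' j) φ) => i = i' ∧ i ≠ j ∧ φ.IsDelta0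
  | .all _ _ => False

/-- Kripke–Platek set theory with urelements, `KPU`: extensionality for sets, urelements
have no members, Pairing, Union, Δ₀-Separation, Δ₀-Collection, and the Foundation
schema. -/
structure KPUModel (u : β → Prop) (Eb EU : β → β → Prop) : Prop where
  urelNoMem : ∀ x, u x → ∀ z, ¬ Eb z x
  euUrel : ∀ x y, EU x y → u x ∧ u y
  exten : ∀ x y, ¬ u x → ¬ u y → (∀ z, Eb z x ↔ Eb z y) → x = y
  pairing : ∀ x y, ∃ p, ¬ u p ∧ ∀ z, Eb z p ↔ (z = x ∨ z = y)
  union : ∀ x, ∃ w, ¬ u w ∧ ∀ z, Eb z w ↔ ∃ y, Eb y x ∧ Eb z y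
  delta0Sep : ∀ φ : UFml, φ.IsDelta0 → ∀ s : ℕ → β, ∀ a,
    ∃ b, ¬ u b ∧ ∀ z, Eb z b ↔ (Eb z a ∧ USat u Eb EU φ (Function.update s 0 z))
  delta0Coll : ∀ φ : UFml, φ.IsDelta0 → ∀ s : ℕ → β, ∀ a,
    (∀ x, Eb x a → ∃ y, USat u Eb EU φ (Function.update (Function.update s 0 x) 1 y)) →
    ∃ b, ∀ x, Eb x a → ∃ y, Eb y b ∧
      USat u Eb EU φ (Function.update (Function.update s 0 x) 1 y)
  foundation : ∀ φ : UFml, ∀ s : ℕ → β,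
    (∃ x, USat u Eb EU φ (Function.update s 0 x)) →
    ∃ x, USat u Eb EU φ (Function.update s 0 x) ∧
      ∀ y, Eb y x → ¬ USat u Eb EU φ (Function.update s 0 y)

/-- The structure `(β, u, Eb, EU)` is a model of `KPU` over the first-order model of set
theory `(α, E)`, with the urelements forming an isomorphic copy of `(α, E)` (via `ι`)
and with the set of all urelements (i.e., `M` itself) existing as an element. -/
def IsKPUOver (E : α → α → Prop) (u : β → Prop) (Eb EU : β → β → Prop)
    (ι : α → β) : Prop :=
  KPUModel u Eb EU ∧
  Function.Injective ι ∧
  (∀ x, u (ι x)) ∧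
  (∀ b, u b → ∃ x, b = ι x) ∧
  (∀ x y, EU (ι x) (ι y) ↔ E x y) ∧
  (∃ m, ¬ u m ∧ ∀ z, Eb z m ↔ u z)

/-- `S ⊆ M` is internal to the `KPU` structure: some element `b` has exactly the
urelements corresponding to `S` as its members. -/
def InternalIn (u : β → Prop) (Eb : β → β → Prop) (ι : α → β) (S : Set α) : Prop :=
  ∃ b, ¬ u b ∧ (∀ z, Eb z b → u z) ∧ ∀ x, (Eb (ι x) b ↔ x ∈ S)

/-- `Hyp(M) ∩ 𝒫(M)`: the collection of all `S ⊆ M` which are internal to every model of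
`KPU` over `M` containing `M` as an element. (For countable `M` this is exactly the
collection of subsets of `M` lying in the least admissible set `Hyp(M)` above `M`.) -/
def HypClasses {α : Type} (E : α → α → Prop) : Set (Set α) :=
  {S | ∀ (β : Type) (u : β → Prop) (Eb EU : β → β → Prop) (ι : α → β),
    IsKPUOver E u Eb EU ι → InternalIn u Eb ι S}

end SOST

namespace SOST

variable {α : Type*}

/-- `GBC`: Gödel–Bernays set theory with Global Choice. -/
def GBC (D : Set α) (E : α → α → Prop) (𝒳 : Set (Set α)) : Prop :=
  GBModel D E 𝒳 ∧ GlobalChoice D E 𝒳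

/-- The Class Collection schema: if for every set `x` there is a class `Y` with
`φ(x, Y, P̄)`, then there is a single class `C` such that for every `x` some slice
`(C)_i` witnesses `φ`. -/
def ClassCollection (D : Set α) (E : α → α → Prop) (𝒳 : Set (Set α)) : Prop :=
  ∀ φ : Fml, ∀ s : ℕ → α, (∀ n, s n ∈ D) → ∀ c : ℕ → Set α, (∀ n, c n ∈ 𝒳) →
    (∀ x ∈ D, ∃ Y ∈ 𝒳,
      Sat D E 𝒳 φ (Function.update s 0 x) (Function.update c 0 Y)) →
    ∃ C ∈ 𝒳, ∀ x ∈ D, ∃ i ∈ D,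
      Sat D E 𝒳 φ (Function.update s 0 x) (Function.update c 0 (slice D E C i))

/-- The Class Choice schema: as Class Collection, but the witnessing slice for `x`
is `(C)_x` itself. -/
def ClassChoice (D : Set α) (E : α → α → Prop) (𝒳 : Set (Set α)) : Prop :=
  ∀ φ : Fml, ∀ s : ℕ → α, (∀ n, s n ∈ D) → ∀ c : ℕ → Set α, (∀ n, c n ∈ 𝒳) →
    (∀ x ∈ D, ∃ Y ∈ 𝒳,
      Sat D E 𝒳 φ (Function.update s 0 x) (Function.update c 0 Y)) →
    ∃ C ∈ 𝒳, ∀ x ∈ D,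
      Sat D E 𝒳 φ (Function.update s 0 x) (Function.update c 0 (slice D E C x))

/-- `x` is internally the empty set (the numeral `0`). -/
def IsZeroIn (D : Set α) (E : α → α → Prop) (x : α) : Prop :=
  x ∈ D ∧ ∀ z ∈ D, ¬ E z x

/-- `x` is internally the numeral `1 = {0}`. -/
def IsOneIn (D : Set α) (E : α → α → Prop) (x : α) : Prop :=
  x ∈ D ∧ ∀ z ∈ D, (E z x ↔ IsZeroIn D E z)

/-- The pair `⟨a, b⟩` is an element of the *set* `p`. -/
def pairInSet (D : Set α) (E : α → α → Prop) (p a b : α) : Prop :=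
  ∃ z ∈ D, E z p ∧ IsKPair D E z a b

/-- `p` is a condition of the class forcing to add a Cohen subclass of `Ord`:
a set-sized binary sequence, i.e. an internal function from some ordinal to `2`. -/
def IsCond (D : Set α) (E : α → α → Prop) (p : α) : Prop :=
  p ∈ D ∧ ∃ γ, IsOrdIn D E γ ∧
    (∀ z ∈ D, E z p → ∃ ξ v, E ξ γ ∧ (IsZeroIn D E v ∨ IsOneIn D E v) ∧
      IsKPair D E z ξ v) ∧
    (∀ ξ ∈ D, E ξ γ → ∃ v, pairInSet D E p ξ v) ∧
    (∀ ξ v v', pairInSet D E p ξ v → pairInSet D E p ξ v' → v = v')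

/-- `q` extends the condition `p` (is a stronger condition). -/
def CondExtends (D : Set α) (E : α → α → Prop) (q p : α) : Prop :=
  ∀ ξ v, pairInSet D E p ξ v → pairInSet D E q ξ v

/-- The condition `p` agrees with the class `C ⊆ Ord` (is an initial segment of its
characteristic function). -/
def AgreesWith (D : Set α) (E : α → α → Prop) (C : Set α) (p : α) : Prop :=
  ∀ ξ v, pairInSet D E p ξ v → ((ξ ∈ C) ↔ IsOneIn D E v)

/-- `C ⊆ Ord` is a Cohen-generic class over the model: it is a class of ordinals
decided below every ordinal by a condition, and it meets every dense class of
conditions definable over the model from set parameters. -/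
def CohenGeneric (D : Set α) (E : α → α → Prop) (C : Set α) : Prop :=
  (∀ x ∈ C, IsOrdIn D E x) ∧
  (∀ γ, IsOrdIn D E γ → ∃ p, IsCond D E p ∧ AgreesWith D E C p ∧
    ∀ ξ ∈ D, E ξ γ → ∃ v, pairInSet D E p ξ v) ∧
  (∀ Δ ∈ Def0 D E, (∀ z ∈ Δ, IsCond D E z) →
    (∀ p, IsCond D E p → ∃ q ∈ Δ, CondExtends D E q p) →
    ∃ p ∈ Δ, AgreesWith D E C p)

/-- `𝒳` is a β-`(GB + ETR)`-realization for the transitive set `M`. -/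
def BetaETRReal (M : ZFSet) (𝒳 : Set (Set ZFSet)) : Prop :=
  GBModel M.toSet (· ∈ ·) 𝒳 ∧ ETR M.toSet (· ∈ ·) 𝒳 ∧ IsBeta M 𝒳

/-- `(D, E, 𝒳)` is (isomorphic to) a β-model: the membership relation is well-founded
and extensional (so the model is isomorphic to a transitive one), and every class
relation in `𝒳` believed to be well-founded is truly well-founded. -/
def BetaReal (D : Set α) (E : α → α → Prop) (𝒳 : Set (Set α)) : Prop :=
  WellFounded (fun x y => x ∈ D ∧ y ∈ D ∧ E x y) ∧
  (∀ x ∈ D, ∀ y ∈ D, (∀ z ∈ D, E z x ↔ E z y) → x = y) ∧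
  ∀ R ∈ 𝒳, IsClassRel D E R → IntWF D E R →
    WellFounded (fun a b => PairIn D E R a b)

end SOST


namespace SOST

section SetTheory

variable {α : Type} (E : α → α → Prop) [hZ : Fact (ZFModel Set.univ E)]

theorem ext_mem {x y : α} (h : ∀ z, E z x ↔ E z y) : x = y :=
  hZ.out.exten x trivial y trivial fun z _ => h z

theorem exists_upair (a b : α) : ∃ p, ∀ z, E z p ↔ z = a ∨ z = b := by
  obtain ⟨p, -, hp⟩ := hZ.out.pairing a trivial b trivial
  exact ⟨p, fun z => hp z trivial⟩

/-- The unordered pair `{a, b}`. -/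
noncomputable def upair (a b : α) : α := (exists_upair E a b).choose

theorem mem_upair {a b z : α} : E z (upair E a b) ↔ z = a ∨ z = b :=
  (exists_upair E a b).choose_spec z

/-- The Kuratowski pair `⟨a, b⟩`. -/
noncomputable def pr (a b : α) : α := upair E (upair E a a) (upair E a b)

variable {E}

theorem isKPair_iff {p a b : α} : IsKPair Set.univ E p a b ↔ p = pr E a b := by
  have key : ∀ z, ((∀ w, E w z ↔ w = a) ∨ (∀ w, E w z ↔ (w = a ∨ w = b))) ↔
      z = upair E a a ∨ z = upair E a b := by
    intro z
    refine or_congr ⟨fun h => ext_mem E fun w => ?_, ?_⟩ ⟨fun h => ext_mem E fun w => ?_, ?_⟩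
    · rw [h, mem_upair E, or_self]
    · rintro rfl w; rw [mem_upair E, or_self]
    · rw [h, mem_upair E]
    · rintro rfl w; rw [mem_upair E]
  constructor
  · rintro ⟨-, -, -, h⟩
    refine ext_mem E fun z => ?_
    rw [pr, mem_upair E, ← key, h z trivial]
    simp
  · rintro rfl
    refine ⟨trivial, trivial, trivial, fun z _ => ?_⟩
    rw [pr, mem_upair E, ← key]
    simp

theorem upair_inj_right {a b c : α} (h : upair E a b = upair E a c) : b = c := by
  have h1 : ∀ z, z = a ∨ z = b ↔ z = a ∨ z = c := fun z => by
    rw [← mem_upair E, ← mem_upair E, h]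
  have hb := (h1 b).1 (Or.inr rfl)
  have hc := (h1 c).2 (Or.inr rfl)
  grind

theorem pr_inj {a b c d : α} : pr E a b = pr E c d ↔ a = c ∧ b = d := by
  constructor
  · intro h
    have h1 : ∀ z, z = upair E a a ∨ z = upair E a b ↔ z = upair E c c ∨ z = upair E c d :=
      fun z => by
      rw [← mem_upair E, ← mem_upair E]; change E z (pr E a b) ↔ E z (pr E c d); rw [h]
    have hac : a = c := by
      have hc : E c (upair E a a) := by
        rcases (h1 _).1 (Or.inl rfl) with e | e <;> rw [e, mem_upair E] <;> simp
      rw [mem_upair E, or_self] at hc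
      exact hc.symm
    subst hac
    exact ⟨rfl, upair_inj_right (upair_inj_right h)⟩
  · rintro ⟨rfl, rfl⟩; rfl

theorem pairIn_iff {R : Set α} {a b : α} : PairIn Set.univ E R a b ↔ pr E a b ∈ R := by
  simp [PairIn, isKPair_iff]

variable (E)

theorem exists_zero : ∃ e : α, ∀ z, ¬ E z e := by
  obtain ⟨-, -, ⟨e, -, -, he⟩, -⟩ := hZ.out.infinity
  exact ⟨e, fun z => he z trivial⟩

/-- The empty set. -/
noncomputable def zero : α := (exists_zero E).choose

theorem not_mem_zero {z : α} : ¬ E z (zero E) := (exists_zero E).choose_spec z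

/-- The iterated singletons of the empty set, used as labels. -/
noncomputable def tag : ℕ → α
  | 0 => zero E
  | n + 1 => upair E (tag n) (tag n)

theorem mem_tag_succ {n : ℕ} {z : α} : E z (tag E (n + 1)) ↔ z = tag E n := by
  rw [tag, mem_upair E, or_self]

theorem tag_inj {m n : ℕ} : tag E m = tag E n ↔ m = n := by
  refine ⟨fun h => ?_, congrArg _⟩
  induction m generalizing n with
  | zero =>
    cases n with
    | zero => rfl
    | succ n => exact absurd (h.symm ▸ (mem_tag_succ E).2 rfl : E (tag E n) (tag E 0)) (not_mem_zero E)
  | succ m ih =>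
    cases n with
    | zero => exact absurd (h ▸ (mem_tag_succ E).2 rfl : E (tag E m) (tag E 0)) (not_mem_zero E)
    | succ n => rw [ih ((mem_tag_succ E).1 (h ▸ (mem_tag_succ E).2 rfl : E (tag E m) (tag E (n + 1))))]

theorem pr_ne_zero {a b : α} : pr E a b ≠ zero E := fun h =>
  not_mem_zero E (z := upair E a a) (h ▸ (mem_upair E).2 (Or.inl rfl))

theorem exists_succ (n : α) : ∃ m, ∀ z, E z m ↔ E z n ∨ z = n := by
  obtain ⟨u, -, hu⟩ := hZ.out.union (upair E n (upair E n n)) trivial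
  refine ⟨u, fun z => ?_⟩
  simp [hu z trivial, mem_upair E]

/-- The successor `n ∪ {n}`. -/
noncomputable def suc (n : α) : α := (exists_succ E n).choose

theorem mem_suc {n z : α} : E z (suc E n) ↔ E z n ∨ z = n := (exists_succ E n).choose_spec z

/-- The class of internal natural numbers. -/
abbrev Nt (n : α) : Prop := IsNatIn Set.univ E n

variable {E}

omit hZ in
theorem Nt.trans {n x y : α} (hn : Nt E n) (hx : E x y) (hy : E y n) : E x n :=
  hn.1.2.1 y trivial hy x trivial hx

theorem Nt.zero : Nt E (zero E) := by
  refine ⟨⟨trivial, fun y _ h => absurd h (not_mem_zero E), fun y _ h => absurd h (not_mem_zero E)⟩,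
    fun y _ h => Or.inl fun z _ hz => ?_⟩
  rcases h with h | rfl
  exacts [not_mem_zero E h, not_mem_zero E hz]

theorem Nt.suc {n : α} (hn : Nt E n) : Nt E (suc E n) := by
  refine ⟨⟨trivial, fun y _ hy z _ hz => ?_, fun y _ hy => ?_⟩, fun y _ hy => ?_⟩
  · rw [mem_suc E] at hy ⊢
    rcases hy with hy | rfl
    exacts [Or.inl (hn.trans hz hy), Or.inl hz]
  · rcases (mem_suc E).1 hy with hy | rfl
    exacts [hn.1.2.2 y trivial hy, hn.1.2.1]
  · rcases hy with hy | rfl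
    · exact hn.2 y trivial ((mem_suc E).1 hy)
    · exact Or.inr ⟨n, trivial, (mem_suc E).2 (Or.inr rfl), fun w _ => mem_suc E⟩

omit hZ in
theorem Nt.of_mem {n m : α} (hn : Nt E n) (hm : E m n) : Nt E m := by
  refine ⟨⟨trivial, hn.1.2.2 m trivial hm, fun y _ hy => hn.1.2.2 y trivial (hn.trans hy hm)⟩,
    fun y _ hy => hn.2 y trivial (Or.inl ?_)⟩
  rcases hy with hy | rfl
  exacts [hn.trans hy hm, hm]

theorem Nt.eq_zero_or_suc {n : α} (hn : Nt E n) :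
    n = SOST.zero E ∨ ∃ m, Nt E m ∧ n = SOST.suc E m := by
  rcases hn.2 n trivial (Or.inr rfl) with h | ⟨m, -, hm, h⟩
  · exact Or.inl (ext_mem E fun z => iff_of_false (h z trivial) (not_mem_zero E))
  · exact Or.inr ⟨m, hn.of_mem hm, ext_mem E fun z => by rw [h z trivial, mem_suc E]⟩

end SetTheory

end SOST

namespace SOST

section Definability

variable {α : Type} (E : α → α → Prop)

/-- Predicates of an assignment of set variables and one class variable which are first-order
definable from set parameters and the class parameters in `𝒜`. -/
inductive DefP (𝒜 : Set (Set α)) : ((ℕ → α) → Set α → Prop) → Prop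
  | mem (i j : ℕ) : DefP 𝒜 fun v _ => E (v i) (v j)
  | eq (i j : ℕ) : DefP 𝒜 fun v _ => v i = v j
  | cst (i : ℕ) (a : α) : DefP 𝒜 fun v _ => v i = a
  | memC (i : ℕ) (A : Set α) (hA : A ∈ 𝒜) : DefP 𝒜 fun v _ => v i ∈ A
  | memU (i : ℕ) : DefP 𝒜 fun v U => v i ∈ U
  | fal : DefP 𝒜 fun _ _ => False
  | imp {P Q : (ℕ → α) → Set α → Prop} (hP : DefP 𝒜 P) (hQ : DefP 𝒜 Q) :
      DefP 𝒜 fun v U => P v U → Q v U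
  | all (i : ℕ) {P : (ℕ → α) → Set α → Prop} (hP : DefP 𝒜 P) :
      DefP 𝒜 fun v U => ∀ x, P (Function.update v i x) U

variable {E} {𝒜 ℬ : Set (Set α)} {P Q : (ℕ → α) → Set α → Prop}

theorem DefP.congr (hP : DefP E 𝒜 P) (h : ∀ v U, Q v U ↔ P v U) : DefP E 𝒜 Q := by
  have : Q = P := funext fun v => funext fun U => propext (h v U)
  rwa [this]

/-- The assignment interleaving `v` (even variables) and `s` (odd variables). -/
def interleave (v s : ℕ → α) (k : ℕ) : α := if k % 2 = 0 then v (k / 2) else s (k / 2)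

theorem interleave_even (v s : ℕ → α) (i : ℕ) : interleave v s (2 * i) = v i := by
  simp [interleave]

theorem interleave_odd (v s : ℕ → α) (i : ℕ) : interleave v s (2 * i + 1) = s i := by
  have h1 : (2 * i + 1) % 2 = 1 := by omega
  have h2 : (2 * i + 1) / 2 = i := by omega
  simp [interleave, h1, h2]

theorem update_interleave (v s : ℕ → α) (i : ℕ) (x : α) :
    Function.update (interleave v s) (2 * i) x = interleave (Function.update v i x) s := by
  funext k
  by_cases hk : k = 2 * i
  · subst hk; simp [interleave]
  · rw [Function.update_of_ne hk]
    unfold interleave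
    split_ifs with h
    · rw [Function.update_of_ne (by omega)]
    · rfl

/-- A definable predicate is expressed by an elementary formula. -/
theorem DefP.exists_fml (hP : DefP E 𝒜 P) :
    ∃ (L : List α) (M : List (Set α)), (∀ A ∈ M, A ∈ 𝒜) ∧
      ∀ (s : ℕ → α) (c : ℕ → Set α), (∀ a ∈ L, ∃ i, s i = a) → (∀ A ∈ M, ∃ i, c i = A) →
        ∃ φ : Fml, φ.IsElementary ∧ ∀ v U 𝒳,
          (Sat Set.univ E 𝒳 φ (interleave v s) (fun n => if n = 0 then U else c (n - 1)) ↔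
            P v U) := by
  induction hP with
  | mem i j =>
    exact ⟨[], [], by simp, fun s c _ _ => ⟨.memSS (2 * i) (2 * j), trivial, fun v U 𝒳 => by
      simp [Sat, interleave_even]⟩⟩
  | eq i j =>
    exact ⟨[], [], by simp, fun s c _ _ => ⟨.eqS (2 * i) (2 * j), trivial, fun v U 𝒳 => by
      simp [Sat, interleave_even]⟩⟩
  | cst i a =>
    refine ⟨[a], [], by simp, fun s c hs _ => ?_⟩
    obtain ⟨j, hj⟩ := hs a (by simp)
    exact ⟨.eqS (2 * i) (2 * j + 1), trivial, fun v U 𝒳 => by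
      simp [Sat, interleave_even, interleave_odd, hj]⟩
  | memC i A hA =>
    refine ⟨[], [A], by simpa using hA, fun s c _ hc => ?_⟩
    obtain ⟨j, hj⟩ := hc A (by simp)
    exact ⟨.memSC (2 * i) (j + 1), trivial, fun v U 𝒳 => by
      simp [Sat, interleave_even, hj]⟩
  | memU i =>
    exact ⟨[], [], by simp, fun s c _ _ => ⟨.memSC (2 * i) 0, trivial, fun v U 𝒳 => by
      simp [Sat, interleave_even]⟩⟩
  | fal => exact ⟨[], [], by simp, fun s c _ _ => ⟨.fal, trivial, fun v U 𝒳 => Iff.rfl⟩⟩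
  | imp _ _ ihP ihQ =>
    obtain ⟨L, M, hM, h⟩ := ihP
    obtain ⟨L', M', hM', h'⟩ := ihQ
    refine ⟨L ++ L', M ++ M', fun A hA => (List.mem_append.1 hA).elim (hM A) (hM' A),
      fun s c hs hc => ?_⟩
    obtain ⟨φ, hφ, hφ'⟩ := h s c (fun a ha => hs a (List.mem_append_left _ ha))
      (fun a ha => hc a (List.mem_append_left _ ha))
    obtain ⟨ψ, hψ, hψ'⟩ := h' s c (fun a ha => hs a (List.mem_append_right _ ha))
      (fun a ha => hc a (List.mem_append_right _ ha))
    exact ⟨φ.imp ψ, ⟨hφ, hψ⟩, fun v U 𝒳 => imp_congr (hφ' v U 𝒳) (hψ' v U 𝒳)⟩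
  | all i _ ih =>
    obtain ⟨L, M, hM, h⟩ := ih
    refine ⟨L, M, hM, fun s c hs hc => ?_⟩
    obtain ⟨φ, hφ, hφ'⟩ := h s c hs hc
    refine ⟨.allS (2 * i) φ, hφ, fun v U 𝒳 => ?_⟩
    simp only [Sat, Set.mem_univ, true_imp_iff, update_interleave]
    exact forall_congr' fun x => hφ' _ U 𝒳

theorem DefP.subst (hP : DefP E 𝒜 P) (h : ∀ A ∈ 𝒜, ∀ i, DefP E ℬ fun v _ => v i ∈ A) :
    DefP E ℬ P := by
  induction hP with
  | mem i j => exact .mem i j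
  | eq i j => exact .eq i j
  | cst i a => exact .cst i a
  | memC i A hA => exact h A hA i
  | memU i => exact .memU i
  | fal => exact .fal
  | imp _ _ ihP ihQ => exact .imp ihP ihQ
  | all i _ ih => exact .all i ih

theorem DefP.at (a : α) (hP : DefP E 𝒜 P) (i : ℕ) :
    DefP E 𝒜 fun v U => P (Function.update v i a) U :=
  (DefP.all i (.imp (.cst i a) hP)).congr fun v U => by simp

/-- An elementary formula defines a definable predicate, whichever variables are kept free. -/
theorem Fml.defP {φ : Fml} (hφ : φ.IsElementary) (𝒳 : Set (Set α)) (s : ℕ → α)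
    {c : Set α → ℕ → Set α} (hc : ∀ m i, DefP E 𝒜 fun v U => v i ∈ c U m) (J : Set ℕ)
    [DecidablePred (· ∈ J)] :
    DefP E 𝒜 fun v U => Sat Set.univ E 𝒳 φ (fun j => if j ∈ J then v j else s j) (c U) := by
  have key : ∀ (R : α → Set α → Prop), (∀ i, DefP E 𝒜 fun v U => R (v i) U) →
      ∀ (J : Set ℕ) [DecidablePred (· ∈ J)] (i : ℕ),
        DefP E 𝒜 fun v U => R (if i ∈ J then v i else s i) U := by
    intro R hR J _ i
    by_cases hi : i ∈ J
    · exact (hR i).congr fun v U => by simp [hi]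
    · exact ((hR i).at (s i) i).congr fun v U => by simp [hi]
  have key2 : ∀ (R : α → α → Prop), (∀ i j, DefP E 𝒜 fun v _ => R (v i) (v j)) →
      ∀ (J : Set ℕ) [DecidablePred (· ∈ J)] (i j : ℕ),
        DefP E 𝒜 fun v _ => R (if i ∈ J then v i else s i) (if j ∈ J then v j else s j) := by
    intro R hR J _ i j
    by_cases hi : i ∈ J <;> by_cases hj : j ∈ J
    · exact (hR i j).congr fun v U => by simp [hi, hj]
    · exact ((hR i j).at (s j) j).congr fun v U => by
        have : i ≠ j := fun h => hj (h ▸ hi)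
        simp [hi, hj, this]
    · exact ((hR i j).at (s i) i).congr fun v U => by
        have : j ≠ i := fun h => hi (h ▸ hj)
        simp [hi, hj, this]
    · refine (((hR i j).at (s i) i).at (s j) j).congr fun v U => ?_
      by_cases h : i = j
      · subst h; simp [hi]
      · simp [hi, hj, Ne.symm h]
  induction φ generalizing J with
  | memSS i j => exact key2 E DefP.mem J i j
  | memSC i m => exact key (fun x U => x ∈ c U m) (hc m) J i
  | eqS i j => exact key2 (· = ·) DefP.eq J i j
  | fal => exact .fal
  | imp φ ψ ihφ ihψ => exact .imp (ihφ hφ.1 J) (ihψ hφ.2 J)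
  | allS i φ ih =>
    classical
    refine (DefP.all i (ih hφ (insert i J))).congr fun v U => ?_
    simp only [Sat, Set.mem_univ, true_imp_iff]
    refine forall_congr' fun x => ?_
    have : Function.update (fun j => if j ∈ J then v j else s j) i x =
        fun j => if j ∈ insert i J then Function.update v i x j else s j := by
      funext j
      by_cases hj : j = i
      · subst hj; simp
      · simp [hj]
    rw [this]
  | allC i φ ih => exact hφ.elim

/-- Contexts of set variables over one class variable. -/
class Env (α : outParam Type) (ρ : Type) where
  len : ℕ
  Agr : ρ → (ℕ → α) → Prop
  cl : ρ → Set α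
  agr_update : ∀ {e v i} (x : α), Agr e v → len ≤ i → Agr e (Function.update v i x)

instance : Env α (Set α) := ⟨0, fun _ _ => True, id, fun _ _ _ => trivial⟩

instance {ρ : Type} [Env α ρ] : Env α (ρ × α) where
  len := Env.len (α := α) ρ + 1
  Agr e v := Env.Agr e.1 v ∧ v (Env.len (α := α) ρ) = e.2
  cl e := Env.cl e.1
  agr_update := fun x h hi =>
    ⟨Env.agr_update x h.1 (by omega), by rw [Function.update_of_ne (by omega)]; exact h.2⟩

variable {ρ : Type} [Env α ρ]

theorem Env.agr_snoc {e : ρ} {v : ℕ → α} (h : Env.Agr e v) (x : α) :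
    Env.Agr (e, x) (Function.update v (Env.len (α := α) ρ) x) :=
  ⟨Env.agr_update x h le_rfl, by simp⟩

variable (E 𝒜)

/-- Definable predicates of a context. -/
def Dfb (P : ρ → Prop) : Prop :=
  ∃ Q, DefP E 𝒜 Q ∧ ∀ e v, Env.Agr e v → (Q v (Env.cl e) ↔ P e)

/-- Definable terms of a context. -/
def DT (x : ρ → α) : Prop := Dfb E 𝒜 fun e : ρ × α => e.2 = x e.1

variable {E 𝒜} {P Q : ρ → Prop} {x y : ρ → α}

theorem Dfb.congr (hP : Dfb E 𝒜 P) (h : ∀ e, Q e ↔ P e) : Dfb E 𝒜 Q := by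
  have : Q = P := funext fun e => propext (h e)
  rwa [this]

theorem Dfb.subst (hP : Dfb E 𝒜 P) (h : ∀ A ∈ 𝒜, ∀ i, DefP E ℬ fun v _ => v i ∈ A) :
    Dfb E ℬ P :=
  let ⟨φ, hφ, hφ'⟩ := hP
  ⟨φ, hφ.subst h, hφ'⟩

theorem Dfb.fal : Dfb E 𝒜 fun _ : ρ => False := ⟨_, .fal, fun _ _ _ => Iff.rfl⟩

theorem Dfb.imp (hP : Dfb E 𝒜 P) (hQ : Dfb E 𝒜 Q) : Dfb E 𝒜 fun e => P e → Q e :=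
  let ⟨_, hφ, hφ'⟩ := hP
  let ⟨_, hψ, hψ'⟩ := hQ
  ⟨_, hφ.imp hψ, fun e v h => imp_congr (hφ' e v h) (hψ' e v h)⟩

theorem Dfb.not (hP : Dfb E 𝒜 P) : Dfb E 𝒜 fun e => ¬ P e := hP.imp .fal

theorem Dfb.or (hP : Dfb E 𝒜 P) (hQ : Dfb E 𝒜 Q) : Dfb E 𝒜 fun e => P e ∨ Q e :=
  (hP.not.imp hQ).congr fun _ => or_iff_not_imp_left

theorem Dfb.and (hP : Dfb E 𝒜 P) (hQ : Dfb E 𝒜 Q) : Dfb E 𝒜 fun e => P e ∧ Q e :=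
  (hP.imp hQ.not).not.congr fun _ => by tauto

theorem Dfb.iff (hP : Dfb E 𝒜 P) (hQ : Dfb E 𝒜 Q) : Dfb E 𝒜 fun e => P e ↔ Q e :=
  ((hP.imp hQ).and (hQ.imp hP)).congr fun _ => iff_iff_implies_and_implies

theorem Dfb.all {P : ρ → α → Prop} (hP : Dfb E 𝒜 fun p : ρ × α => P p.1 p.2) :
    Dfb E 𝒜 fun e => ∀ x, P e x :=
  let ⟨_, hφ, hφ'⟩ := hP
  ⟨_, hφ.all (Env.len (α := α) ρ), fun e _ h => forall_congr' fun x =>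
    hφ' (e, x) _ (Env.agr_snoc h x)⟩

theorem Dfb.ex {P : ρ → α → Prop} (hP : Dfb E 𝒜 fun p : ρ × α => P p.1 p.2) :
    Dfb E 𝒜 fun e => ∃ x, P e x :=
  (Dfb.all (P := fun e x => ¬ P e x) hP.not).not.congr fun _ => by simp

theorem DT.weaken (hx : DT E 𝒜 x) : DT E 𝒜 fun e : ρ × α => x e.1 := by
  obtain ⟨φ, hφ, hφ'⟩ := hx
  refine ⟨_, (DefP.eq (Env.len (α := α) ρ) (Env.len (α := α) ρ + 1)).imp hφ |>.all
    (Env.len (α := α) ρ), fun e v h => ?_⟩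
  have h1 : v (Env.len (α := α) ρ + 1) = e.2 := h.2
  have h2 : Env.Agr e.1.1 v := h.1.1
  refine ⟨fun H => (hφ' (e.1.1, e.2) _ (Env.agr_snoc h2 _)).1 (H e.2 (by simp [h1])),
    fun H y hy => (hφ' (e.1.1, y) _ (Env.agr_snoc h2 _)).2 ?_⟩
  have hy : y = e.2 := by simpa [h1] using hy
  exact hy.trans H

theorem DT.const (a : α) : DT E 𝒜 fun _ : ρ => a :=
  ⟨_, .cst (Env.len (α := α) ρ) a, fun e v h => by rw [h.2]⟩

theorem DT.v0 : DT E 𝒜 fun e : ρ × α => e.2 :=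
  ⟨_, .eq (Env.len (α := α) ρ + 1) (Env.len (α := α) ρ), fun e v h => by
    have h1 : v (Env.len (α := α) ρ + 1) = e.2 := h.2
    have h2 : v (Env.len (α := α) ρ) = e.1.2 := h.1.2
    rw [h1, h2]⟩

theorem DT.v1 : DT E 𝒜 fun e : (ρ × α) × α => e.1.2 := DT.v0.weaken
theorem DT.v2 : DT E 𝒜 fun e : ((ρ × α) × α) × α => e.1.1.2 := DT.v1.weaken
theorem DT.v3 : DT E 𝒜 fun e : (((ρ × α) × α) × α) × α => e.1.1.1.2 := DT.v2.weaken
theorem DT.v4 : DT E 𝒜 fun e : ((((ρ × α) × α) × α) × α) × α => e.1.1.1.1.2 := DT.v3.weaken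
theorem DT.v5 : DT E 𝒜 fun e : (((((ρ × α) × α) × α) × α) × α) × α => e.1.1.1.1.1.2 :=
  DT.v4.weaken
theorem DT.v6 : DT E 𝒜 fun e : ((((((ρ × α) × α) × α) × α) × α) × α) × α => e.1.1.1.1.1.1.2 :=
  DT.v5.weaken
theorem DT.v7 : DT E 𝒜 fun e : (((((((ρ × α) × α) × α) × α) × α) × α) × α) × α =>
    e.1.1.1.1.1.1.1.2 :=
  DT.v6.weaken

/-- Substitution of a definable term for the last variable. -/
theorem Dfb.inst {P : ρ × α → Prop} (hP : Dfb E 𝒜 P) (hx : DT E 𝒜 x) :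
    Dfb E 𝒜 fun e => P (e, x e) := by
  have h : Dfb E 𝒜 fun e : ρ => ∀ y, y = x e → P (e, y) := Dfb.all (Dfb.imp hx hP)
  exact h.congr fun e => by simp

theorem Dfb.eq (hx : DT E 𝒜 x) (hy : DT E 𝒜 y) : Dfb E 𝒜 fun e => x e = y e :=
  Dfb.inst hy hx

theorem Dfb.memC {A : Set α} (hA : A ∈ 𝒜) (hx : DT E 𝒜 x) : Dfb E 𝒜 fun e => x e ∈ A :=
  Dfb.inst (P := fun e : ρ × α => e.2 ∈ A)
    ⟨_, .memC (Env.len (α := α) ρ) A hA, fun e v h => by rw [h.2]⟩ hx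

theorem Dfb.memU (hx : DT E 𝒜 x) : Dfb E 𝒜 fun e => x e ∈ Env.cl e :=
  Dfb.inst (P := fun e : ρ × α => e.2 ∈ Env.cl e.1)
    ⟨_, .memU (Env.len (α := α) ρ), fun e v h => by rw [h.2]; rfl⟩ hx

theorem Dfb.mem (hx : DT E 𝒜 x) (hy : DT E 𝒜 y) : Dfb E 𝒜 fun e => E (x e) (y e) := by
  have h : Dfb E 𝒜 fun e : (ρ × α) × α => E e.1.2 e.2 :=
    ⟨_, .mem (Env.len (α := α) ρ) (Env.len (α := α) ρ + 1), fun e v h => by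
      have h1 : v (Env.len (α := α) ρ + 1) = e.2 := h.2
      have h2 : v (Env.len (α := α) ρ) = e.1.2 := h.1.2
      rw [h1, h2]⟩
  exact Dfb.inst (Dfb.inst h hy.weaken) hx

theorem DT.pr [Fact (ZFModel Set.univ E)] (hx : DT E 𝒜 x) (hy : DT E 𝒜 y) :
    DT E 𝒜 fun e => SOST.pr E (x e) (y e) := by
  have h : Dfb E 𝒜 fun e : ((ρ × α) × α) × α => e.1.1.2 = SOST.pr E e.1.2 e.2 := by
    have : Dfb E 𝒜 fun e : ((ρ × α) × α) × α => ∀ z, E z e.1.1.2 ↔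
        ((∀ w, E w z ↔ w = e.1.2) ∨ ∀ w, E w z ↔ (w = e.1.2 ∨ w = e.2)) := by
      repeat' first
        | exact DT.v0 | exact DT.v1 | exact DT.v2 | exact DT.v3 | exact DT.v4
        | apply Dfb.all | apply Dfb.iff | apply Dfb.or | apply Dfb.mem
    refine this.congr fun e => ?_
    rw [← isKPair_iff]
    simp [IsKPair]
  exact Dfb.inst (Dfb.inst h hy.weaken.weaken) hx.weaken

/-- Definable classes. -/
theorem Dfb.defP {X : Set α} (hX : Dfb E 𝒜 fun e : Set α × α => e.2 ∈ X) (i : ℕ) :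
    DefP E 𝒜 fun v _ => v i ∈ X := by
  obtain ⟨Q, hQ, h⟩ := hX
  have h' : ∀ v U, Q v U ↔ v 0 ∈ X := fun v U => h (U, v 0) v ⟨trivial, rfl⟩
  by_cases hi : i = 0
  · subst hi
    exact hQ.congr fun v U => (h' v U).symm
  · refine (DefP.all 0 (.imp (.eq 0 i) hQ)).congr fun v U => ?_
    simp [h', hi]

theorem DefP.dfb {P : (ℕ → α) → Set α → Prop} {R : Set α → α → Prop} (hP : DefP E 𝒜 P)
    (h : ∀ v U, P v U ↔ R U (v 0)) : Dfb E 𝒜 fun e : Set α × α => R e.1 e.2 :=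
  ⟨P, hP, fun e v he => by rw [h, show v 0 = e.2 from he.2]; rfl⟩

/-- A definable class of a model of `GB` belongs to the model. -/
theorem Dfb.mem_of_gb [Nonempty α] {𝒳 : Set (Set α)} (hGB : GBModel Set.univ E 𝒳)
    {A : Set α} (hA : A ∈ 𝒳) (h𝒜 : 𝒜 ⊆ 𝒳) {X : Set α}
    (hX : Dfb E 𝒜 fun e : Set α × α => e.2 ∈ X) : X ∈ 𝒳 := by
  obtain ⟨Q, hQ, h⟩ := hX
  obtain ⟨L, M, hM, H⟩ := hQ.exists_fml
  obtain ⟨φ, hφ, hφ'⟩ := H (fun i => L.getD i (Classical.arbitrary α)) (fun i => M.getD i A)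
    (fun a ha => by
      obtain ⟨i, hi, rfl⟩ := List.mem_iff_getElem.1 ha
      exact ⟨i, by simp [hi]⟩)
    (fun a ha => by
      obtain ⟨i, hi, rfl⟩ := List.mem_iff_getElem.1 ha
      exact ⟨i, by simp [hi]⟩)
  obtain ⟨Y, hY, hY'⟩ := hGB.elemComp φ hφ (interleave (fun _ => Classical.arbitrary α)
    fun i => L.getD i (Classical.arbitrary α)) (fun _ => trivial)
    (fun n => if n = 0 then A else M.getD (n - 1) A) (fun n => by
      split_ifs with hn
      · exact hA
      · by_cases hl : n - 1 < M.length
        · simpa [hl] using h𝒜 (hM _ (List.getElem_mem hl))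
        · simpa [hl] using hA)
  have : X = Y := by
    ext x
    have := update_interleave (fun _ => Classical.arbitrary α)
      (fun i => L.getD i (Classical.arbitrary α)) 0 x
    rw [mul_zero] at this
    rw [hY' x trivial, this, hφ']
    exact (h (A, x) _ ⟨trivial, Function.update_self _ _ _⟩).symm
  exact this ▸ hY

/-- Recursion along `lt` for definable predicates. -/
theorem ETRFor.exists_sol [Fact (ZFModel Set.univ E)] [Nonempty α] {𝒳 : Set (Set α)} {F : Set α}
    {lt : α → α → Prop} (hF : ETRFor Set.univ E 𝒳 F lt) {A : Set α} (hA : A ∈ 𝒳)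
    {P : Set α → α → Prop} (hP : Dfb E {A} fun e : Set α × α => P e.1 e.2) :
    ∃ S ∈ 𝒳, (∀ z ∈ S, ∃ r x, r ∈ F ∧ z = SOST.pr E r x) ∧ ∀ r ∈ F, ∀ x,
      (SOST.pr E r x ∈ S ↔ P {z | z ∈ S ∧ ∃ r' x, lt r' r ∧ z = SOST.pr E r' x} x) := by
  obtain ⟨Q, hQ, h⟩ := hP
  obtain ⟨L, M, hM, H⟩ := hQ.exists_fml
  obtain ⟨φ, hφ, hφ'⟩ := H (fun i => L.getD i (Classical.arbitrary α)) (fun i => A)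
    (fun a ha => by
      obtain ⟨i, hi, rfl⟩ := List.mem_iff_getElem.1 ha
      exact ⟨i, by simp [hi]⟩)
    (fun a ha => ⟨0, (hM a ha).symm⟩)
  obtain ⟨S, hS, hS1, hS2⟩ := hF φ hφ A hA (interleave (fun _ => Classical.arbitrary α)
    fun i => L.getD i (Classical.arbitrary α)) (fun _ => trivial)
  refine ⟨S, hS, fun z hz => ?_, fun r hr x => ?_⟩
  · obtain ⟨r, x, hr, -, hx⟩ := hS1 z hz
    exact ⟨r, x, hr, (isKPair_iff).1 hx⟩
  · have := update_interleave (fun _ => Classical.arbitrary α)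
      (fun i => L.getD i (Classical.arbitrary α)) 0 x
    rw [mul_zero] at this
    rw [← pairIn_iff, hS2 r hr x trivial, this, hφ']
    simp only [sliceRestrict, isKPair_iff]
    exact h (_, x) _ ⟨trivial, Function.update_self _ _ _⟩

end Definability

end SOST

namespace SOST

section WellFounded

variable {α : Type} {E : α → α → Prop} {𝒳 : Set (Set α)} {W : Set α}

/-- The standing assumptions: a model of `GB`, a nonempty class well-order `W` and elementary
recursion along `W · ω`. -/
structure RecModel (E : α → α → Prop) (𝒳 : Set (Set α)) (W : Set α) : Prop where
  gb : GBModel Set.univ E 𝒳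
  mem : W ∈ 𝒳
  wo : IsClassWO Set.univ E W
  ne : (relFld Set.univ E W).Nonempty
  etr : ETRFor Set.univ E 𝒳 (timesOmegaFld Set.univ E (relFld Set.univ E W))
    (timesOmegaLt Set.univ E (relFld Set.univ E W) (PairIn Set.univ E W))

variable [hZ : Fact (ZFModel Set.univ E)]

omit hZ in
theorem Dfb.nt {𝒜 : Set (Set α)} {ρ : Type} [Env α ρ] {x : ρ → α} (hx : DT E 𝒜 x) :
    Dfb E 𝒜 fun e => Nt E (x e) := by
  have : Dfb E 𝒜 fun e : ρ × α => Nt E e.2 := by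
    unfold Nt IsNatIn IsOrdIn IsTransIn
    simp only [Set.mem_univ, true_imp_iff, true_and]
    repeat' first
      | exact DT.v0 | exact DT.v1 | exact DT.v2 | exact DT.v3 | exact DT.v4
      | apply Dfb.not | apply Dfb.all | apply Dfb.and | apply Dfb.iff | apply Dfb.or
      | apply Dfb.ex | apply Dfb.mem | apply Dfb.eq | apply Dfb.imp
  exact Dfb.inst this hx

theorem DT.suc {𝒜 : Set (Set α)} {ρ : Type} [Env α ρ] {x : ρ → α} (hx : DT E 𝒜 x) :
    DT E 𝒜 fun e => SOST.suc E (x e) := by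
  have h : Dfb E 𝒜 fun e : (ρ × α) × α => e.1.2 = SOST.suc E e.2 := by
    have : Dfb E 𝒜 fun e : (ρ × α) × α => ∀ z, E z e.1.2 ↔ E z e.2 ∨ z = e.2 :=
      Dfb.all (Dfb.iff (Dfb.mem DT.v0 DT.v2) (Dfb.or (Dfb.mem DT.v0 DT.v1) (Dfb.eq DT.v0 DT.v1)))
    exact this.congr fun e =>
      ⟨fun h z => by rw [h, mem_suc E], fun h => ext_mem E fun z => by rw [h, mem_suc E]⟩
  exact Dfb.inst h hx.weaken

omit hZ in
theorem Dfb.app {𝒜 : Set (Set α)} {ρ : Type} [Env α ρ] {x : ρ → α} {P : α → Prop}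
    (hP : Dfb E 𝒜 fun e : Set α × α => P e.2) (hx : DT E 𝒜 x) : Dfb E 𝒜 fun e => P (x e) :=
  Dfb.inst (P := fun e : ρ × α => P e.2)
    ⟨_, Dfb.defP (X := {x | P x}) hP (Env.len (α := α) ρ), fun e v h => by rw [h.2]; rfl⟩ hx

/-- Elementary recursion along a transitive relation yields minimal elements of classes. -/
theorem ETRFor.induction [Nonempty α] {F : Set α} {lt : α → α → Prop}
    (hF : ETRFor Set.univ E 𝒳 F lt) (hGB : GBModel Set.univ E 𝒳) {A : Set α} (hA : A ∈ 𝒳)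
    (hlt : ∀ p q r, lt p q → lt q r → lt p r) (hfld : ∀ p q, lt p q → p ∈ F) {P : α → Prop}
    (hP : Dfb E 𝒳 fun e : Set α × α => P e.2)
    (h : ∀ p ∈ F, (∀ q, lt q p → P q) → P p) : ∀ p ∈ F, P p := by
  have hX : {p | ¬ P p} ∈ 𝒳 := Dfb.mem_of_gb hGB hA (le_refl _) hP.not
  obtain ⟨S, -, -, hS⟩ := hF.exists_sol hX
    (P := fun U _ => ∀ q y, pr E q y ∈ U → q ∉ {p | ¬ P p}) (by
      apply Dfb.all; apply Dfb.all
      refine Dfb.imp (Dfb.memU (DT.pr DT.v1 DT.v0)) (Dfb.not (Dfb.memC rfl DT.v1)))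
  obtain ⟨x0⟩ := ‹Nonempty α›
  have key : ∀ r ∈ F, ∀ x, (pr E r x ∈ S ↔ ∀ q y, lt q r → pr E q y ∈ S → P q) := by
    intro r hr x
    rw [hS r hr x]
    refine forall_congr' fun q => forall_congr' fun y => ?_
    simp only [Set.mem_ofPred_eq, not_not, pr_inj]
    constructor
    · intro H h1 h2
      exact H ⟨h2, q, y, h1, rfl, rfl⟩
    · rintro H ⟨h2, r', x, h1, rfl, rfl⟩
      exact H h1 h2
  have step : ∀ p ∈ F, ¬ P p → ∃ q, lt q p ∧ ¬ P q := fun p hp hn => by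
    by_contra hc
    push Not at hc
    exact hn (h p hp hc)
  have none : ∀ p ∈ F, ¬ P p → ∀ x, pr E p x ∉ S := by
    intro p hp hn x hx
    have h1 := (key p hp x).1 hx
    obtain ⟨q, hq, hqn⟩ := step p hp hn
    have h2 : pr E q x0 ∉ S := fun h' => hqn (h1 q x0 hq h')
    rw [key q (hfld _ _ hq)] at h2
    push Not at h2
    obtain ⟨q', y, hq', hy, hn'⟩ := h2
    exact hn' (h1 q' y (hlt _ _ _ hq' hq) hy)
  intro p hp
  by_contra hn
  refine none p hp hn x0 ((key p hp x0).2 fun q y hq hy => ?_)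
  by_contra hqn
  exact none q (hfld _ _ hq) hqn y hy

variable (E W)

/-- The strict order `W`. -/
abbrev Rl (a b : α) : Prop := pr E a b ∈ W

/-- The field of `W`. -/
def Gm (a : α) : Prop := ∃ b, pr E a b ∈ W ∨ pr E b a ∈ W

/-- The stages, that is the field of `W · ω`. -/
def Stg (p : α) : Prop := ∃ n g, Nt E n ∧ Gm E W g ∧ p = pr E n g

/-- The order of `W · ω`. -/
def Lex (p q : α) : Prop := ∃ n g m h, p = pr E n g ∧ q = pr E m h ∧ Nt E n ∧ Nt E m ∧
  Gm E W g ∧ Gm E W h ∧ (E n m ∨ n = m ∧ Rl E W g h)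

variable {E W}

theorem mem_relFld {a : α} : a ∈ relFld Set.univ E W ↔ Gm E W a := by
  simp [relFld, Gm, pairIn_iff]

theorem mem_stg {p : α} : p ∈ timesOmegaFld Set.univ E (relFld Set.univ E W) ↔ Stg E W p := by
  simp [timesOmegaFld, Stg, isKPair_iff, mem_relFld]

theorem lex_iff {p q : α} : timesOmegaLt Set.univ E (relFld Set.univ E W)
    (PairIn Set.univ E W) p q ↔ Lex E W p q := by
  simp [timesOmegaLt, Lex, isKPair_iff, mem_relFld, pairIn_iff]

theorem lex_pr {n g m h : α} : Lex E W (pr E n g) (pr E m h) ↔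
    Nt E n ∧ Nt E m ∧ Gm E W g ∧ Gm E W h ∧ (E n m ∨ n = m ∧ Rl E W g h) := by
  constructor
  · rintro ⟨n', g', m', h', e1, e2, H⟩
    obtain ⟨rfl, rfl⟩ := (pr_inj).1 e1
    obtain ⟨rfl, rfl⟩ := (pr_inj).1 e2
    exact H
  · intro H
    exact ⟨n, g, m, h, rfl, rfl, H⟩

theorem Lex.left {p q : α} (h : Lex E W p q) : Stg E W p := by
  obtain ⟨n, g, m, h, rfl, rfl, h1, h2, h3, h4, -⟩ := h
  exact ⟨n, g, h1, h3, rfl⟩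

theorem Lex.right {p q : α} (h : Lex E W p q) : Stg E W q := by
  obtain ⟨n, g, m, h, rfl, rfl, h1, h2, h3, h4, -⟩ := h
  exact ⟨m, h, h2, h4, rfl⟩

theorem Rl.left {a b : α} (h : Rl E W a b) : Gm E W a := ⟨b, Or.inl h⟩

theorem Rl.right {a b : α} (h : Rl E W a b) : Gm E W b := ⟨a, Or.inr h⟩

namespace RecModel

variable (hM : RecModel E 𝒳 W)
include hM

omit hZ in
theorem nonempty : Nonempty α := ⟨hM.ne.choose⟩

theorem exists_gm : ∃ g, Gm E W g := ⟨_, mem_relFld.1 hM.ne.choose_spec⟩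

theorem rl_trans {a b c : α} (h : Rl E W a b) (h' : Rl E W b c) : Rl E W a c :=
  pairIn_iff.1 (hM.wo.2.2.1 a (mem_relFld.2 h.left) b (mem_relFld.2 h.right) c
    (mem_relFld.2 h'.right) (pairIn_iff.2 h) (pairIn_iff.2 h'))

theorem rl_total {a b : α} (ha : Gm E W a) (hb : Gm E W b) : a = b ∨ Rl E W a b ∨ Rl E W b a := by
  have := hM.wo.2.2.2.1 a (mem_relFld.2 ha) b (mem_relFld.2 hb)
  rwa [pairIn_iff, pairIn_iff] at this

theorem lex_trans {p q r : α} (h : Lex E W p q) (h' : Lex E W q r) : Lex E W p r := by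
  obtain ⟨n, g, m, h, rfl, rfl, h1, h2, h3, h4, h5⟩ := h
  obtain ⟨m', h', k, i, e, rfl, -, k2, -, k4, k5⟩ := h'
  obtain ⟨rfl, rfl⟩ := (pr_inj).1 e
  rw [lex_pr]
  refine ⟨h1, k2, h3, k4, ?_⟩
  rcases h5 with h5 | ⟨rfl, h5⟩ <;> rcases k5 with k5 | ⟨rfl, k5⟩
  · exact Or.inl (k2.trans h5 k5)
  · exact Or.inl h5
  · exact Or.inl k5
  · exact Or.inr ⟨rfl, hM.rl_trans h5 k5⟩

/-- Induction on stages, for definable predicates. -/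
theorem stg_ind {P : α → Prop} (hP : Dfb E 𝒳 fun e : Set α × α => P e.2)
    (h : ∀ p, Stg E W p → (∀ q, Lex E W q p → P q) → P p) : ∀ p, Stg E W p → P p := by
  have := hM.nonempty
  intro p hp
  refine hM.etr.induction hM.gb hM.mem (fun p q r => ?_) (fun p q => ?_) hP
    (fun p hp H => ?_) p (mem_stg.2 hp)
  · simpa only [lex_iff] using hM.lex_trans
  · simpa only [lex_iff, mem_stg] using Lex.left
  · exact h p (mem_stg.1 hp) fun q hq => H q (lex_iff.2 hq)

/-- Induction along `W`, for definable predicates. -/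
theorem gm_ind {P : α → Prop} (hP : Dfb E 𝒳 fun e : Set α × α => P e.2)
    (h : ∀ g, Gm E W g → (∀ g', Rl E W g' g → P g') → P g) : ∀ g, Gm E W g → P g := by
  intro g hg
  refine hM.stg_ind (P := fun p => ∀ g, p = pr E (zero E) g → P g) ?_ ?_ (pr E (zero E) g)
    ⟨_, _, Nt.zero, hg, rfl⟩ g rfl
  · apply Dfb.all
    exact Dfb.imp (Dfb.eq DT.v1 (DT.pr (DT.const _) DT.v0))
      (hP.app DT.v0)
  · rintro p ⟨n, g, hn, hg, rfl⟩ H g' e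
    obtain ⟨rfl, rfl⟩ := (pr_inj).1 e
    exact h g hg fun g' hg' => H _ (lex_pr.2 ⟨hn, hn, hg'.left, hg, Or.inr ⟨rfl, hg'⟩⟩) g' rfl

/-- Strong induction on internal natural numbers, for definable predicates. -/
theorem nt_strong_ind {P : α → Prop} (hP : Dfb E 𝒳 fun e : Set α × α => P e.2)
    (h : ∀ n, Nt E n → (∀ m, E m n → P m) → P n) : ∀ n, Nt E n → P n := by
  intro n hn
  obtain ⟨g, hg⟩ := hM.exists_gm
  refine hM.stg_ind (P := fun p => ∀ n g, p = pr E n g → P n) ?_ ?_ (pr E n g)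
    ⟨_, _, hn, hg, rfl⟩ n g rfl
  · exact Dfb.all (Dfb.all (Dfb.imp (Dfb.eq DT.v2 (DT.pr DT.v1 DT.v0)) (hP.app DT.v1)))
  · rintro p ⟨n, g, hn, hg, rfl⟩ H n' g' e
    obtain ⟨rfl, rfl⟩ := pr_inj.1 e
    exact h n hn fun m hm => H _ (lex_pr.2 ⟨hn.of_mem hm, hn, hg, hg, Or.inl hm⟩) m g rfl

/-- Induction on internal natural numbers, for definable predicates. -/
theorem nt_ind {P : α → Prop} (hP : Dfb E 𝒳 fun e : Set α × α => P e.2) (h0 : P (zero E))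
    (hs : ∀ n, Nt E n → P n → P (suc E n)) : ∀ n, Nt E n → P n := by
  refine hM.nt_strong_ind hP fun n hn ih => ?_
  rcases hn.eq_zero_or_suc with rfl | ⟨m, hm, rfl⟩
  exacts [h0, hs m hm (ih m ((mem_suc E).2 (Or.inr rfl)))]

theorem nt_zero_mem : ∀ m, Nt E m → zero E = m ∨ E (zero E) m := by
  refine hM.nt_ind (Dfb.or (Dfb.eq (DT.const _) DT.v0) (Dfb.mem (DT.const _) DT.v0))
    (Or.inl rfl) fun n hn ih => Or.inr ((mem_suc E).2 ?_)
  exact ih.symm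

theorem nt_suc_mem : ∀ n, Nt E n → ∀ m, E m n → E (suc E m) n ∨ suc E m = n := by
  refine hM.nt_ind ?_ (fun m hm => absurd hm (not_mem_zero E)) fun n hn ih m hm => ?_
  · exact Dfb.all (Dfb.imp (Dfb.mem DT.v0 DT.v1)
      (Dfb.or (Dfb.mem DT.v0.suc DT.v1) (Dfb.eq DT.v0.suc DT.v1)))
  · rw [mem_suc E] at hm ⊢
    rcases hm with hm | rfl
    · exact Or.inl (ih m hm)
    · exact Or.inr rfl

theorem nt_total {m n : α} (hm : Nt E m) (hn : Nt E n) : m = n ∨ E m n ∨ E n m := by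
  revert m
  suffices ∀ n, Nt E n → ∀ m, Nt E m → m = n ∨ E m n ∨ E n m from fun {m} => this n hn m
  refine hM.nt_ind ?_ (fun m hm => ?_) fun n hn ih m hm => ?_
  · exact Dfb.all (Dfb.imp (Dfb.nt DT.v0) (Dfb.or (Dfb.eq DT.v0 DT.v1)
      (Dfb.or (Dfb.mem DT.v0 DT.v1) (Dfb.mem DT.v1 DT.v0))))
  · rcases hM.nt_zero_mem m hm with rfl | h
    exacts [Or.inl rfl, Or.inr (Or.inr h)]
  · rw [mem_suc E]
    rcases ih m hm with rfl | h | h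
    · exact Or.inr (Or.inl (Or.inr rfl))
    · exact Or.inr (Or.inl (Or.inl h))
    · rcases hM.nt_suc_mem m hm n h with h | h
      exacts [Or.inr (Or.inr h), Or.inl h.symm]

theorem lex_total {p q : α} (hp : Stg E W p) (hq : Stg E W q) :
    p = q ∨ Lex E W p q ∨ Lex E W q p := by
  obtain ⟨n, g, hn, hg, rfl⟩ := hp
  obtain ⟨m, h, hm, hh, rfl⟩ := hq
  simp only [lex_pr, pr_inj, hn, hm, hg, hh, true_and]
  rcases hM.nt_total hn hm with rfl | h1 | h1
  · rcases hM.rl_total hg hh with rfl | h2 | h2 <;> tauto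
  · tauto
  · tauto

end RecModel

end WellFounded

end SOST

namespace SOST

section Recursion

variable {α : Type} (E : α → α → Prop) [hZ : Fact (ZFModel Set.univ E)]

/-- The judgement that the statement with code `t` holds of the list `s`, relative to the
block `k` and to the recursion with code `e` along `W` at the point `r`. -/
noncomputable def tup (k e r t s : α) : α := pr E (pr E k (pr E e r)) (pr E t s)

/-- Code of a disjunction of two negations. -/
noncomputable def cN (t u : α) : α := pr E (tag E 0) (pr E t u)
/-- Code of an existential quantification over a negation. -/
noncomputable def cEx (t : α) : α := pr E (tag E 1) t
/-- Code of the negation of a statement not depending on the second list entry. -/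
noncomputable def cSk (t : α) : α := pr E (tag E 2) t
/-- Code for the first list entry not being in the partial solution. -/
noncomputable def cH : α := pr E (tag E 3) (zero E)
/-- Code for the first two list entries being equal. -/
noncomputable def cEq : α := pr E (tag E 4) (zero E)
/-- Code for the first list entry being a member of the second one. -/
noncomputable def cMem : α := pr E (tag E 5) (zero E)
/-- Code for the first list entry being equal to `a`. -/
noncomputable def cCst (a : α) : α := pr E (tag E 6) a
/-- Code for the first list entry being in the class parameter. -/
noncomputable def cA : α := pr E (tag E 7) (zero E)
/-- Code for the first list entry being in the part of the universal recursion below the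
current block. -/
noncomputable def cB : α := pr E (tag E 8) (zero E)

/-- The judgements decided to be true without referring to other judgements. -/
def Static (A U : Set α) (a : α) : Prop := ∃ k e r s,
  (∃ z, a = tup E k e r (cH E) (pr E z s) ∧
    ¬ ∃ r' y, z = pr E r' y ∧ pr E (tag E 0) (pr E r' r) ∈ A) ∨
  (∃ x, a = tup E k e r (cEq E) (pr E x (pr E x s))) ∨
  (∃ x y, a = tup E k e r (cMem E) (pr E x (pr E y s)) ∧ E x y) ∨
  (∃ x, a = tup E k e r (cCst E x) (pr E x s)) ∨
  (∃ x, a = tup E k e r (cA E) (pr E x s) ∧ x ∈ A) ∨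
  ∃ n g y, a = tup E k e r (cB E) (pr E (pr E (pr E n g) y) s) ∧ pr E (pr E n g) y ∈ U ∧ E n k

/-- `b` is a premise of the judgement `a`: a judgement is true if and only if one of its
premises is false. The premise `zero` is a false judgement. -/
def Prem (A U : Set α) (a b : α) : Prop :=
  (∃ k e r s t u, a = tup E k e r (cN E t u) s ∧ (b = tup E k e r t s ∨ b = tup E k e r u s)) ∨
  (∃ k e r s t x, a = tup E k e r (cEx E t) s ∧ b = tup E k e r t (pr E x s)) ∨
  (∃ k e r s t x y, a = tup E k e r (cSk E t) (pr E x (pr E y s)) ∧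
    b = tup E k e r t (pr E x s)) ∨
  (∃ k e r s r' y, a = tup E k e r (cH E) (pr E (pr E r' y) s) ∧ b = tup E k e r' e (pr E y y) ∧
    pr E (tag E 0) (pr E r' r) ∈ A) ∨
  (b = zero E ∧ Static E A U a)

/-- The part `U` of the recursion suffices to determine the premises of `a`. -/
def Ready (U : Set α) (a : α) : Prop :=
  ∀ k e r s, a = tup E k e r (cB E) s → ∃ g y, pr E (pr E k g) y ∈ U

/-- One step of the universal recursion. -/
def Step (A U : Set α) (x : α) : Prop := ∃ a, Ready E U a ∧
  ((x = pr E (tag E 1) a ∧ ∃ b, Prem E A U a b ∧ ∃ q, pr E q (pr E (tag E 0) b) ∈ U) ∨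
    (x = pr E (tag E 0) a ∧ ∀ b, Prem E A U a b → ∃ q, pr E q (pr E (tag E 1) b) ∈ U))

variable {E}

set_option maxHeartbeats 1000000 in
theorem Dfb.step (A : Set α) : Dfb E {A} fun e : Set α × α => Step E A e.1 e.2 := by
  unfold Step Ready Prem Static tup cN cEx cSk cH cEq cMem cCst cA cB
  repeat' first
    | exact DT.const _
    | exact DT.v0 | exact DT.v1 | exact DT.v2 | exact DT.v3 | exact DT.v4
    | exact DT.v5 | exact DT.v6 | exact DT.v7
    | exact (DT.v7 (E := E)).weaken | exact (DT.v7 (E := E)).weaken.weaken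
    | apply DT.pr
    | exact rfl
    | apply Dfb.ex | apply Dfb.and | apply Dfb.or | apply Dfb.all | apply Dfb.not | apply Dfb.eq
    | apply Dfb.mem | apply Dfb.memC | apply Dfb.memU | apply Dfb.imp

end Recursion

end SOST

namespace SOST

section Solutions

variable {α : Type} (E : α → α → Prop) [hZ : Fact (ZFModel Set.univ E)]
  (𝒳 : Set (Set α)) (W A S : Set α)

/-- The part of `S` at stages below `q`. -/
def res (q : α) : Set α := {z | z ∈ S ∧ ∃ r' x, Lex E W r' q ∧ z = pr E r' x}

/-- `S` is the universal recursion along `W · ω` with parameter `A`, which codes `W`. -/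
structure Sol : Prop where
  hA : ∀ x, pr E (tag E 0) x ∈ A ↔ x ∈ W
  memA : A ∈ 𝒳
  memS : S ∈ 𝒳
  stg : ∀ z ∈ S, ∃ q x, Stg E W q ∧ z = pr E q x
  spec : ∀ q, Stg E W q → ∀ x, (pr E q x ∈ S ↔ Step E A (res E W S q) x)

/-- The judgement `a` is marked by `i` before stage `q`: it is true for `i = 1` and false for
`i = 0`. -/
def Mk (i : ℕ) (q a : α) : Prop := ∃ q', Lex E W q' q ∧ pr E q' (pr E (tag E i) a) ∈ S

/-- Before stage `q` it is decided that the judgement `a` is equivalent to `p`. -/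
def Correct (q a : α) (p : Prop) : Prop := (p → Mk E W S 1 q a) ∧ (¬ p → Mk E W S 0 q a)

variable {E 𝒳 W A S}

theorem Dfb.lex {𝒜 : Set (Set α)} {ρ : Type} [Env α ρ] (hW : W ∈ 𝒜) {x y : ρ → α}
    (hx : DT E 𝒜 x) (hy : DT E 𝒜 y) : Dfb E 𝒜 fun e => Lex E W (x e) (y e) := by
  have : Dfb E 𝒜 fun e : (ρ × α) × α => Lex E W e.1.2 e.2 := by
    unfold Lex Gm
    repeat' first
      | exact DT.v0 | exact DT.v1 | exact DT.v2 | exact DT.v3 | exact DT.v4 | exact DT.v5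
      | exact DT.v6 | apply DT.pr | exact hW
      | apply Dfb.ex | apply Dfb.nt | apply Dfb.and | apply Dfb.or | apply Dfb.eq
      | apply Dfb.mem | apply Dfb.memC
  exact Dfb.inst (Dfb.inst this hy.weaken) hx

theorem Dfb.stg {𝒜 : Set (Set α)} {ρ : Type} [Env α ρ] (hW : W ∈ 𝒜) {x : ρ → α}
    (hx : DT E 𝒜 x) : Dfb E 𝒜 fun e => Stg E W (x e) := by
  have : Dfb E 𝒜 fun e : ρ × α => Stg E W e.2 := by
    unfold Stg Gm
    repeat' first
      | exact DT.v0 | exact DT.v1 | exact DT.v2 | exact DT.v3 | exact DT.v4 | exact DT.v5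
      | apply DT.pr | exact hW
      | apply Dfb.ex | apply Dfb.nt | apply Dfb.and | apply Dfb.or | apply Dfb.eq
      | apply Dfb.memC
  exact Dfb.inst this hx

theorem Dfb.mk {𝒜 : Set (Set α)} {ρ : Type} [Env α ρ] (hW : W ∈ 𝒜) (hS : S ∈ 𝒜) (i : ℕ)
    {x y : ρ → α} (hx : DT E 𝒜 x) (hy : DT E 𝒜 y) : Dfb E 𝒜 fun e => Mk E W S i (x e) (y e) := by
  have : Dfb E 𝒜 fun e : (ρ × α) × α => Mk E W S i e.1.2 e.2 :=
    Dfb.ex (Dfb.and (Dfb.lex hW DT.v0 DT.v2) (Dfb.memC hS (DT.pr DT.v0 (DT.pr (DT.const _) DT.v1))))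
  exact Dfb.inst (Dfb.inst this hy.weaken) hx

theorem mem_res {q r x : α} : pr E r x ∈ res E W S q ↔ pr E r x ∈ S ∧ Lex E W r q := by
  constructor
  · rintro ⟨h, r', x', h', e⟩
    obtain ⟨rfl, rfl⟩ := pr_inj.1 e
    exact ⟨h, h'⟩
  · exact fun ⟨h, h'⟩ => ⟨h, r, x, h', rfl⟩

theorem mk_iff {i : ℕ} {q a : α} :
    Mk E W S i q a ↔ ∃ q', pr E q' (pr E (tag E i) a) ∈ res E W S q :=
  exists_congr fun _ => by rw [mem_res, and_comm]

theorem Static.congr {U U' : Set α} {a : α} (h : ∀ k e r s n g y,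
    a = tup E k e r (cB E) (pr E (pr E (pr E n g) y) s) → E n k →
      pr E (pr E n g) y ∈ U → pr E (pr E n g) y ∈ U') (ha : Static E A U a) :
    Static E A U' a := by
  obtain ⟨k, e, r, s, h1 | h1 | h1 | h1 | h1 | ⟨n, g, y, h1, h2, h3⟩⟩ := ha
  · exact ⟨k, e, r, s, Or.inl h1⟩
  · exact ⟨k, e, r, s, Or.inr (Or.inl h1)⟩
  · exact ⟨k, e, r, s, Or.inr (Or.inr (Or.inl h1))⟩
  · exact ⟨k, e, r, s, Or.inr (Or.inr (Or.inr (Or.inl h1)))⟩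
  · exact ⟨k, e, r, s, Or.inr (Or.inr (Or.inr (Or.inr (Or.inl h1))))⟩
  · exact ⟨k, e, r, s, Or.inr (Or.inr (Or.inr (Or.inr (Or.inr
      ⟨n, g, y, h1, h _ _ _ _ _ _ _ h1 h3 h2, h3⟩))))⟩

theorem Prem.congr {U U' : Set α} {a b : α} (h : Static E A U a → Static E A U' a)
    (ha : Prem E A U a b) : Prem E A U' a b := by
  obtain h1 | h1 | h1 | h1 | h1 := ha
  · exact Or.inl h1
  · exact Or.inr (Or.inl h1)
  · exact Or.inr (Or.inr (Or.inl h1))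
  · exact Or.inr (Or.inr (Or.inr (Or.inl h1)))
  · exact Or.inr (Or.inr (Or.inr (Or.inr ⟨h1.1, h h1.2⟩)))

theorem step_one {U : Set α} {a : α} : Step E A U (pr E (tag E 1) a) ↔
    Ready E U a ∧ ∃ b, Prem E A U a b ∧ ∃ q, pr E q (pr E (tag E 0) b) ∈ U := by
  simp [Step, pr_inj, tag_inj]

theorem step_zero {U : Set α} {a : α} : Step E A U (pr E (tag E 0) a) ↔
    Ready E U a ∧ ∀ b, Prem E A U a b → ∃ q, pr E q (pr E (tag E 1) b) ∈ U := by
  simp [Step, pr_inj, tag_inj]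

theorem not_prem_zero {U : Set α} {b : α} : ¬ Prem E A U (zero E) b := by
  simp only [Prem, Static, tup, (pr_ne_zero E).symm, false_and, exists_false, and_false, or_false,
    not_false_eq_true]

/-- The universal recursion exists; its parameter `A` codes `W`. -/
theorem RecModel.exists_sol (hM : RecModel E 𝒳 W) (hA : ∀ x, pr E (tag E 0) x ∈ A ↔ x ∈ W)
    (memA : A ∈ 𝒳) : ∃ S, Sol E 𝒳 W A S := by
  have := hM.nonempty
  obtain ⟨S, hS, h1, h2⟩ := hM.etr.exists_sol memA (Dfb.step A)
  refine ⟨S, hA, memA, hS, fun z hz => ?_, fun q hq x => ?_⟩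
  · obtain ⟨r, x, hr, rfl⟩ := h1 z hz
    exact ⟨r, x, mem_stg.1 hr, rfl⟩
  · rw [h2 q (mem_stg.2 hq) x]
    simp only [lex_iff]
    rfl

namespace Sol

variable (hM : RecModel E 𝒳 W) (hS : Sol E 𝒳 W A S)
include hM

theorem mk_mono {i : ℕ} {q q' a : α} (h : Lex E W q q')
    (ha : Mk E W S i q a) : Mk E W S i q' a :=
  let ⟨p, hp, hp'⟩ := ha
  ⟨p, hM.lex_trans hp h, hp'⟩

theorem correct_mono {q q' a : α} {p : Prop} (h : Lex E W q q') (ha : Correct E W S q a p) :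
    Correct E W S q' a p :=
  ⟨fun hp => mk_mono hM h (ha.1 hp), fun hp => mk_mono hM h (ha.2 hp)⟩

include hS

theorem prem_iff {q a b : α} (ha : Ready E (res E W S q) a) :
    Prem E A (res E W S q) a b ↔ Prem E A S a b := by
  refine ⟨fun h => h.congr fun h => h.congr fun k e r s n g y _ _ h => h.1,
    fun h => h.congr fun h => h.congr fun k e r s n g y he hn hy => ?_⟩
  obtain ⟨g', y', hg⟩ := ha k e r _ he
  rw [mem_res] at hg ⊢
  refine ⟨hy, hM.lex_trans (lex_pr.2 ?_) hg.2⟩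
  obtain ⟨n', h', hn', hh', e1⟩ := hg.2.left
  obtain ⟨rfl, rfl⟩ := pr_inj.1 e1
  obtain ⟨q', x', ⟨n2, g2, hn2, hg2, rfl⟩, e2⟩ := hS.stg _ hy
  obtain ⟨e3, rfl⟩ := pr_inj.1 e2
  obtain ⟨rfl, rfl⟩ := pr_inj.1 e3
  exact ⟨hn2, hn', hg2, hh', Or.inl hn⟩

theorem mark_one {q a : α} (hq : Stg E W q) : pr E q (pr E (tag E 1) a) ∈ S ↔
    Ready E (res E W S q) a ∧ ∃ b, Prem E A S a b ∧ Mk E W S 0 q b := by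
  rw [hS.spec q hq, step_one]
  refine and_congr_right fun h => exists_congr fun b => ?_
  rw [hS.prem_iff hM h, mk_iff]

theorem mark_zero {q a : α} (hq : Stg E W q) : pr E q (pr E (tag E 0) a) ∈ S ↔
    Ready E (res E W S q) a ∧ ∀ b, Prem E A S a b → Mk E W S 1 q b := by
  rw [hS.spec q hq, step_zero]
  refine and_congr_right fun h => forall_congr' fun b => ?_
  rw [hS.prem_iff hM h, mk_iff]

theorem consistent {p a : α} (h1 : Mk E W S 1 p a) (h0 : Mk E W S 0 p a) : False := by
  have hp : Stg E W p := h1.choose_spec.1.right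
  revert a
  refine hM.stg_ind (P := fun p => ∀ {a}, Mk E W S 1 p a → Mk E W S 0 p a → False) ?_ ?_ p hp
  · exact Dfb.all (Dfb.imp (Dfb.mk hM.mem hS.memS 1 DT.v1 DT.v0)
      (Dfb.imp (Dfb.mk hM.mem hS.memS 0 DT.v1 DT.v0) Dfb.fal))
  · rintro p - ih a ⟨q1, hq1, h1⟩ ⟨q0, hq0, h0⟩
    obtain ⟨-, b, hb, hb0⟩ := (hS.mark_one hM hq1.left).1 h1
    have hb1 := ((hS.mark_zero hM hq0.left).1 h0).2 b hb
    rcases hM.lex_total hq1.left hq0.left with rfl | h | h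
    · exact ih q1 hq1 hb1 hb0
    · exact ih q0 hq0 hb1 (mk_mono hM h hb0)
    · exact ih q1 hq1 (mk_mono hM h hb1) hb0

theorem zero_mem {q : α} (hq : Stg E W q) : pr E q (pr E (tag E 0) (zero E)) ∈ S := by
  refine (hS.mark_zero hM hq).2 ⟨fun k e r s he => ?_, fun b hb => ?_⟩
  · exact absurd he.symm (pr_ne_zero E)
  · exact absurd hb not_prem_zero

/-- A judgement is decided once its premises are. -/
theorem decide {q0 q a : α} {p : Prop} (h : Lex E W q0 q) (ha : Ready E (res E W S q0) a)
    (h1 : p → ∃ b, Prem E A S a b ∧ Mk E W S 0 q0 b)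
    (h0 : ¬ p → ∀ b, Prem E A S a b → Mk E W S 1 q0 b) : Correct E W S q a p :=
  ⟨fun hp => ⟨q0, h, (hS.mark_one hM h.left).2 ⟨ha, h1 hp⟩⟩,
    fun hp => ⟨q0, h, (hS.mark_zero hM h.left).2 ⟨ha, h0 hp⟩⟩⟩

end Sol

end Solutions

end SOST

namespace SOST

section Representation

variable {α : Type} {E : α → α → Prop} [hZ : Fact (ZFModel Set.univ E)]
  {𝒳 : Set (Set α)} {W A S : Set α}

variable (E S) in
/-- The part of `S` below block `k`. -/
def lower (k : α) : Set α := {z | z ∈ S ∧ ∃ n g y, z = pr E (pr E n g) y ∧ E n k}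

section Premises

variable {k e r s t u b : α}

theorem prem_cN : Prem E A S (tup E k e r (cN E t u) s) b ↔
    b = tup E k e r t s ∨ b = tup E k e r u s := by
  simp [Prem, Static, tup, cN, cEx, cSk, cH, cEq, cMem, cCst, cA, cB, pr_inj, tag_inj]

theorem prem_cEx : Prem E A S (tup E k e r (cEx E t) s) b ↔ ∃ x, b = tup E k e r t (pr E x s) := by
  simp [Prem, Static, tup, cN, cEx, cSk, cH, cEq, cMem, cCst, cA, cB, pr_inj, tag_inj]

theorem prem_cSk {x y : α} : Prem E A S (tup E k e r (cSk E t) (pr E x (pr E y s))) b ↔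
    b = tup E k e r t (pr E x s) := by
  simp [Prem, Static, tup, cN, cEx, cSk, cH, cEq, cMem, cCst, cA, cB, pr_inj, tag_inj]

theorem prem_cH {z : α} (hA : ∀ x, pr E (tag E 0) x ∈ A ↔ x ∈ W) :
    Prem E A S (tup E k e r (cH E) (pr E z s)) b ↔
      (∃ r' y, z = pr E r' y ∧ b = tup E k e r' e (pr E y y) ∧ Rl E W r' r) ∨
        b = zero E ∧ ¬ ∃ r' y, z = pr E r' y ∧ Rl E W r' r := by
  simp [Prem, Static, tup, cN, cEx, cSk, cH, cEq, cMem, cCst, cA, cB, pr_inj, tag_inj, hA]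

theorem prem_cEq {x y : α} : Prem E A S (tup E k e r (cEq E) (pr E x (pr E y s))) b ↔
    b = zero E ∧ x = y := by
  simp [Prem, Static, tup, cN, cEx, cSk, cH, cEq, cMem, cCst, cA, cB, pr_inj, tag_inj, eq_comm]

theorem prem_cMem {x y : α} : Prem E A S (tup E k e r (cMem E) (pr E x (pr E y s))) b ↔
    b = zero E ∧ E x y := by
  simp [Prem, Static, tup, cN, cEx, cSk, cH, cEq, cMem, cCst, cA, cB, pr_inj, tag_inj]

theorem prem_cCst {x a : α} : Prem E A S (tup E k e r (cCst E a) (pr E x s)) b ↔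
    b = zero E ∧ x = a := by
  simp [Prem, Static, tup, cN, cEx, cSk, cH, cEq, cMem, cCst, cA, cB, pr_inj, tag_inj, eq_comm]

theorem prem_cA {x : α} : Prem E A S (tup E k e r (cA E) (pr E x s)) b ↔
    b = zero E ∧ x ∈ A := by
  simp [Prem, Static, tup, cN, cEx, cSk, cH, cEq, cMem, cCst, cA, cB, pr_inj, tag_inj]

theorem prem_cB {x : α} : Prem E A S (tup E k e r (cB E) (pr E x s)) b ↔
    b = zero E ∧ x ∈ lower E S k := by
  simp only [Prem, Static, tup, cN, cEx, cSk, cH, cEq, cMem, cCst, cA, cB, pr_inj, tag_inj, lower]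
  simp only [Nat.reduceEqDiff, false_and, and_false, exists_false, false_or]
  refine and_congr_right fun _ => ⟨?_, ?_⟩
  · rintro ⟨k', e', r', s', n, g, y, ⟨⟨rfl, rfl, rfl⟩, -, rfl, rfl⟩, h1, h2⟩
    exact ⟨h1, n, g, y, rfl, h2⟩
  · rintro ⟨h1, n, g, y, rfl, h2⟩
    exact ⟨k, e, r, s, n, g, y, ⟨⟨rfl, rfl, rfl⟩, trivial, rfl, rfl⟩, h1, h2⟩

end Premises

variable (E W S)

/-- Stages before `q` reach block `k`. -/
def Past (k q : α) : Prop := ∃ g, Lex E W (pr E k g) q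

/-- Before stage `q`, the partial solution `U` at the point `r` of the recursion with code `e`
is completely decided. -/
def Good (k e r : α) (U : Set α) (q : α) : Prop :=
  Past E W k q ∧ ∀ z s, Correct E W S q (tup E k e r (cH E) (pr E z s)) (z ∉ U)

/-- There are at least `d` stages in `[p, q)`. -/
def Chain : ℕ → α → α → Prop
  | 0, p, q => p = q ∨ Lex E W p q
  | d + 1, p, q => ∃ m, Chain d p m ∧ Lex E W m q

/-- The set coding a list of `n` sets with remainder `s`. -/
noncomputable def enc : ℕ → (ℕ → α) → α → α
  | 0, _, s => s
  | n + 1, v, s => pr E (v 0) (enc n (fun i => v (i + 1)) s)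

/-- Prepending to a sequence. -/
def cons (x : α) (v : ℕ → α) : ℕ → α
  | 0 => x
  | i + 1 => v i

/-- The predicate `P` of lists of length `n` and a partial solution is expressed by a code,
relative to the block `k`. -/
def Rep (k : α) (n : ℕ) (P : (ℕ → α) → Set α → Prop) : Prop :=
  ∃ t d, ∀ e r U q0 q, Good E W S k e r U q0 → Chain E W d q0 q → ∀ v s,
    Correct E W S q (tup E k e r t (enc E n v s)) (P v U)

variable {E W S} {k : α}

theorem Rep.congr {n : ℕ} {P Q : (ℕ → α) → Set α → Prop} (hP : Rep E W S k n P)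
    (h : ∀ v U, Q v U ↔ P v U) : Rep E W S k n Q := by
  have : Q = P := funext fun v => funext fun U => propext (h v U)
  rwa [this]

section Operations

variable (hM : RecModel E 𝒳 W) (hS : Sol E 𝒳 W A S)
include hM

theorem Past.mono {q q' : α} (hk : Past E W k q) (h : Lex E W q q') : Past E W k q' :=
  let ⟨g, hg⟩ := hk
  ⟨g, hM.lex_trans hg h⟩

theorem Chain.le {d : ℕ} {p q : α} (h : Chain E W d p q) : p = q ∨ Lex E W p q := by
  induction d generalizing q with
  | zero => exact h
  | succ d ih =>
    obtain ⟨m, hm, h⟩ := h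
    rcases ih hm with rfl | hm
    exacts [Or.inr h, Or.inr (hM.lex_trans hm h)]

theorem Chain.mono {d d' : ℕ} {p q : α} (hd : d ≤ d') (h : Chain E W d' p q) :
    Chain E W d p q := by
  induction d' generalizing q d with
  | zero => rwa [Nat.le_zero.1 hd]
  | succ d' ih =>
    cases d with
    | zero => exact h.le hM
    | succ d =>
      obtain ⟨m, hm, h'⟩ := h
      exact ⟨m, ih (by omega) hm, h'⟩

theorem Good.mono {e r q q' : α} {U : Set α} (h : Good E W S k e r U q) (hq : Lex E W q q') :
    Good E W S k e r U q' :=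
  ⟨h.1.mono hM hq, fun z s => Sol.correct_mono hM hq (h.2 z s)⟩

include hS

theorem Past.ready {q e r t s : α} (hk : Past E W k q) :
    Ready E (res E W S q) (tup E k e r t s) := by
  intro k' e' r' s' he
  obtain ⟨g, hg⟩ := hk
  obtain ⟨h1, -⟩ := pr_inj.1 he
  obtain ⟨rfl, -⟩ := pr_inj.1 h1
  exact ⟨g, _, mem_res.2 ⟨hS.zero_mem hM hg.left, hg⟩⟩

/-- A code all of whose judgements are either axioms or have no premises. -/
theorem Rep.atom {n : ℕ} {P : (ℕ → α) → Prop} (t : α)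
    (h : ∀ e r v s b, Prem E A S (tup E k e r t (enc E n v s)) b ↔ b = zero E ∧ P v) :
    Rep E W S k n fun v _ => P v := by
  refine ⟨t, 1, fun e r U q0 q hg ⟨m, hm, hq⟩ v s => ?_⟩
  have hk : Past E W k m := by
    rcases hm with rfl | hm
    exacts [hg.1, hg.1.mono hM hm]
  refine hS.decide hM hq (hk.ready hM hS) (fun hp => ⟨_, (h e r v s _).2 ⟨rfl, hp⟩, ?_⟩)
    fun hp b hb => absurd ((h e r v s b).1 hb).2 hp
  obtain ⟨g, hg⟩ := hk
  exact ⟨_, hg, hS.zero_mem hM hg.left⟩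

theorem Rep.nor {n : ℕ} {P Q : (ℕ → α) → Set α → Prop} (hP : Rep E W S k n P)
    (hQ : Rep E W S k n Q) : Rep E W S k n fun v U => ¬ P v U ∨ ¬ Q v U := by
  obtain ⟨t, d, h⟩ := hP
  obtain ⟨u, d', h'⟩ := hQ
  refine ⟨cN E t u, max d d' + 1, fun e r U q0 q hg ⟨m, hm, hq⟩ v s => ?_⟩
  have hk : Past E W k m := by
    rcases hm.le hM with rfl | hm
    exacts [hg.1, hg.1.mono hM hm]
  have h1 := h e r U q0 m hg (hm.mono hM (le_max_left _ _)) v s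
  have h2 := h' e r U q0 m hg (hm.mono hM (le_max_right _ _)) v s
  refine hS.decide hM hq (hk.ready hM hS) (fun hp => ?_) fun hp b hb => ?_
  · rcases hp with hp | hp
    · exact ⟨_, prem_cN.2 (Or.inl rfl), h1.2 hp⟩
    · exact ⟨_, prem_cN.2 (Or.inr rfl), h2.2 hp⟩
  · push Not at hp
    rcases prem_cN.1 hb with rfl | rfl
    exacts [h1.1 hp.1, h2.1 hp.2]

theorem Rep.exNot {n : ℕ} {P : (ℕ → α) → Set α → Prop} (hP : Rep E W S k (n + 1) P) :
    Rep E W S k n fun v U => ∃ x, ¬ P (cons x v) U := by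
  obtain ⟨t, d, h⟩ := hP
  refine ⟨cEx E t, d + 1, fun e r U q0 q hg ⟨m, hm, hq⟩ v s => ?_⟩
  have hk : Past E W k m := by
    rcases hm.le hM with rfl | hm
    exacts [hg.1, hg.1.mono hM hm]
  refine hS.decide hM hq (hk.ready hM hS) (fun hp => ?_) fun hp b hb => ?_
  · obtain ⟨x, hx⟩ := hp
    exact ⟨_, prem_cEx.2 ⟨x, rfl⟩, (h e r U q0 m hg hm (cons x v) s).2 hx⟩
  · push Not at hp
    obtain ⟨x, rfl⟩ := prem_cEx.1 hb
    exact (h e r U q0 m hg hm (cons x v) s).1 (hp x)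

theorem Rep.skip {n : ℕ} {P : (ℕ → α) → Set α → Prop} (hP : Rep E W S k (n + 1) P) :
    Rep E W S k (n + 2) fun v U => ¬ P (cons (v 0) fun i => v (i + 2)) U := by
  obtain ⟨t, d, h⟩ := hP
  refine ⟨cSk E t, d + 1, fun e r U q0 q hg ⟨m, hm, hq⟩ v s => ?_⟩
  have hk : Past E W k m := by
    rcases hm.le hM with rfl | hm
    exacts [hg.1, hg.1.mono hM hm]
  refine hS.decide hM hq (hk.ready hM hS) (fun hp => ?_) fun hp b hb => ?_
  · exact ⟨_, prem_cSk.2 rfl, (h e r U q0 m hg hm (cons (v 0) fun i => v (i + 2)) s).2 hp⟩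
  · obtain rfl := prem_cSk.1 hb
    exact (h e r U q0 m hg hm (cons (v 0) fun i => v (i + 2)) s).1 (not_not.1 hp)

omit hS in
theorem Rep.notMem (n : ℕ) : Rep E W S k (n + 1) fun v U => v 0 ∉ U := by
  refine ⟨cH E, 0, fun e r U q0 q hg h v s => ?_⟩
  rcases h with rfl | h
  exacts [hg.2 _ _, Sol.correct_mono hM h (hg.2 _ _)]

theorem Rep.not {n : ℕ} {P : (ℕ → α) → Set α → Prop} (hP : Rep E W S k n P) :
    Rep E W S k n fun v U => ¬ P v U :=
  (hP.nor hM hS hP).congr fun _ _ => (or_self_iff).symm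

theorem Rep.imp {n : ℕ} {P Q : (ℕ → α) → Set α → Prop} (hP : Rep E W S k n P)
    (hQ : Rep E W S k n Q) : Rep E W S k n fun v U => P v U → Q v U :=
  (hP.nor hM hS (hQ.not hM hS)).congr fun _ _ => by tauto

theorem Rep.and {n : ℕ} {P Q : (ℕ → α) → Set α → Prop} (hP : Rep E W S k n P)
    (hQ : Rep E W S k n Q) : Rep E W S k n fun v U => P v U ∧ Q v U :=
  ((hP.nor hM hS hQ).not hM hS).congr fun _ _ => by tauto

theorem Rep.ex {n : ℕ} {P : (ℕ → α) → Set α → Prop} (hP : Rep E W S k (n + 1) P) :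
    Rep E W S k n fun v U => ∃ x, P (cons x v) U :=
  ((hP.not hM hS).exNot hM hS).congr fun _ _ => by simp

theorem Rep.all {n : ℕ} {P : (ℕ → α) → Set α → Prop} (hP : Rep E W S k (n + 1) P) :
    Rep E W S k n fun v U => ∀ x, P (cons x v) U :=
  ((hP.exNot hM hS).not hM hS).congr fun _ _ => by simp

theorem Rep.cst (n : ℕ) (a : α) : Rep E W S k (n + 1) fun v _ => v 0 = a :=
  Rep.atom hM hS (cCst E a) fun _ _ _ _ _ => prem_cCst

theorem Rep.fal (n : ℕ) : Rep E W S k n fun _ _ => False :=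
  (((Rep.cst hM hS n (zero E)).and hM hS ((Rep.cst hM hS n (zero E)).not hM hS)).ex hM hS).congr
    fun _ _ => by simp

end Operations

/-- `f` is constant or a projection to one of the first `n` entries. -/
def IsProj (n : ℕ) (f : (ℕ → α) → α) : Prop :=
  (∃ j < n, f = fun v => v j) ∨ ∃ a, f = fun _ => a

omit hZ in
theorem IsProj.tail {n : ℕ} {f : (ℕ → α) → α} (hf : IsProj n f) :
    IsProj (n + 1) fun v => f fun i => v (i + 1) := by
  rcases hf with ⟨j, hj, rfl⟩ | ⟨a, rfl⟩
  exacts [Or.inl ⟨j + 1, by omega, rfl⟩, Or.inr ⟨a, rfl⟩]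

omit hZ in
theorem IsProj.head {n : ℕ} : IsProj (α := α) (n + 1) fun v => v 0 := Or.inl ⟨0, by omega, rfl⟩

section Definable

variable (hM : RecModel E 𝒳 W) (hS : Sol E 𝒳 W A S)
include hM hS

theorem Rep.proj {n : ℕ} {f : (ℕ → α) → α} (hf : IsProj n f) :
    Rep E W S k (n + 1) fun v _ => v 0 = f fun i => v (i + 1) := by
  rcases hf with ⟨j, hj, rfl⟩ | ⟨a, rfl⟩
  · induction j generalizing n with
    | zero =>
      obtain ⟨n, rfl⟩ := Nat.exists_eq_succ_of_ne_zero hj.ne'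
      exact Rep.atom hM hS (cEq E) fun _ _ _ _ _ => prem_cEq
    | succ j ih =>
      obtain ⟨n, rfl⟩ := Nat.exists_eq_succ_of_ne_zero (Nat.ne_zero_of_lt hj)
      exact (((ih (n := n) (by omega)).not hM hS).skip hM hS).congr fun v U => by simp [cons]
  · exact Rep.cst hM hS n a

/-- Substitution of a projection for the first list entry. -/
theorem Rep.inst {n : ℕ} {f : (ℕ → α) → α} (hf : IsProj n f) {P : (ℕ → α) → Set α → Prop}
    (hP : Rep E W S k (n + 1) P) : Rep E W S k n fun v U => P (cons (f v) v) U :=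
  (((Rep.proj hM hS hf).and hM hS hP).ex hM hS).congr fun v U => by simp [cons]

/-- Predicates definable from the part of the recursion below block `k` are expressed by
codes relative to `k`. -/
theorem DefP.rep {P : (ℕ → α) → Set α → Prop} (hP : DefP E {lower E S k} P) :
    ∀ (n : ℕ) (σ : ℕ → (ℕ → α) → α), (∀ i, IsProj n (σ i)) →
      Rep E W S k n fun v U => P (fun i => σ i v) U := by
  induction hP with
  | mem i j =>
    intro n σ hσ
    have : Rep E W S k (n + 2) fun v _ => E (v 0) (v 1) :=
      Rep.atom hM hS (cMem E) fun _ _ _ _ _ => prem_cMem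
    exact Rep.inst hM hS (hσ j) (Rep.inst hM hS (hσ i).tail this)
  | eq i j =>
    intro n σ hσ
    have : Rep E W S k (n + 2) fun v _ => v 0 = v 1 :=
      Rep.atom hM hS (cEq E) fun _ _ _ _ _ => prem_cEq
    exact Rep.inst hM hS (hσ j) (Rep.inst hM hS (hσ i).tail this)
  | cst i a => exact fun n σ hσ => Rep.inst hM hS (hσ i) (Rep.cst hM hS n a)
  | memC i B hB =>
    intro n σ hσ
    obtain rfl := hB
    have : Rep E W S k (n + 1) fun v _ => v 0 ∈ lower E S k :=
      Rep.atom hM hS (cB E) fun _ _ _ _ _ => prem_cB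
    exact Rep.inst hM hS (hσ i) this
  | memU i =>
    intro n σ hσ
    exact (Rep.inst hM hS (hσ i) ((Rep.notMem hM n).not hM hS)).congr fun v U => by simp [cons]
  | fal => exact fun n σ hσ => Rep.fal hM hS n
  | imp _ _ ihP ihQ => exact fun n σ hσ => (ihP n σ hσ).imp hM hS (ihQ n σ hσ)
  | all i _ ih =>
    intro n σ hσ
    refine (Rep.all hM hS (ih (n + 1) (fun j w => if j = i then w 0 else σ j fun i => w (i + 1))
      fun j => ?_)).congr fun v U => forall_congr' fun x => ?_
    · by_cases h : j = i
      · simpa only [h, if_true] using IsProj.head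
      · simpa only [h, if_false] using (hσ j).tail
    · have : Function.update (fun i => σ i v) i x =
          fun j => if j = i then (cons x v) 0 else σ j fun i => (cons x v) (i + 1) := by
        funext j
        by_cases h : j = i
        · subst h; simp [cons]
        · simp [h, cons]
      rw [this]

end Definable

end Representation

end SOST

namespace SOST

section Decision

variable {α : Type} {E : α → α → Prop} [hZ : Fact (ZFModel Set.univ E)]
  {𝒳 : Set (Set α)} {W A S : Set α}

variable (E W) in
/-- The stages below `p`, or all stages if `p` is not a stage. -/
def Cut (p q : α) : Prop := Stg E W q ∧ (Stg E W p → Lex E W q p)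

theorem Dfb.cut {𝒜 : Set (Set α)} {ρ : Type} [Env α ρ] (hW : W ∈ 𝒜) {x y : ρ → α}
    (hx : DT E 𝒜 x) (hy : DT E 𝒜 y) : Dfb E 𝒜 fun e => Cut E W (x e) (y e) :=
  Dfb.and (Dfb.stg hW hy) (Dfb.imp (Dfb.stg hW hx) (Dfb.lex hW hy hx))

variable (E W) in
/-- The stages of `Cut E W p` have no last element. -/
def LimCut (p : α) : Prop := ∀ q, Cut E W p q → ∃ q', Cut E W p q' ∧ Lex E W q q'

theorem LimCut.exists_chain {p q : α} (hp : LimCut E W p) (hq : Cut E W p q) (d : ℕ) :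
    ∃ q', Cut E W p q' ∧ Chain E W d q q' := by
  induction d with
  | zero => exact ⟨q, hq, Or.inl rfl⟩
  | succ d ih =>
    obtain ⟨m, hm, hqm⟩ := ih
    obtain ⟨q', hq', h⟩ := hp m hm
    exact ⟨q', hq', m, hqm, h⟩

theorem limCut_zero : LimCut E W (zero E) := by
  have hz : ¬ Stg E W (zero E) := by
    rintro ⟨n, g, -, -, h⟩
    exact pr_ne_zero E h.symm
  rintro q ⟨⟨n, g, hn, hg, rfl⟩, -⟩
  have h : Lex E W (pr E n g) (pr E (suc E n) g) :=
    lex_pr.2 ⟨hn, hn.suc, hg, hg, Or.inl ((mem_suc E).2 (Or.inr rfl))⟩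
  exact ⟨_, ⟨h.right, fun h => absurd h hz⟩, h⟩

theorem Chain.split (d : ℕ) {p q : α} (h : Chain E W (d + 1) p q)
    (hM : RecModel E 𝒳 W) : ∃ m, Lex E W p m ∧ Chain E W d m q := by
  induction d generalizing q with
  | zero =>
    obtain ⟨m, rfl | hm, h⟩ := h
    exacts [⟨q, h, Or.inl rfl⟩, ⟨q, hM.lex_trans hm h, Or.inl rfl⟩]
  | succ d ih =>
    obtain ⟨m, hm, h⟩ := h
    obtain ⟨m', h1, h2⟩ := ih hm
    exact ⟨m', h1, m, h2, h⟩

section Combinatorics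

variable (hM : RecModel E 𝒳 W) {k : α} (hk : Nt E k) {Done : α → α → Prop} {d : ℕ}
  (hD : ∀ {ρ : Type} [Env α ρ] {x y : ρ → α}, DT E 𝒳 x → DT E 𝒳 y →
    Dfb E 𝒳 fun e => Done (x e) (y e))
  (mono : ∀ r q q', Lex E W q q' → Done r q → Done r q')
  (step : ∀ r q0 q, Gm E W r → Past E W k q0 → (∀ r', Rl E W r' r → Done r' q0) →
    Chain E W d q0 q → Done r q)
include hM

theorem RecModel.exists_min : ∃ g, Gm E W g ∧ ∀ g', ¬ Rl E W g' g := by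
  by_contra h
  push Not at h
  obtain ⟨g, hg⟩ := hM.exists_gm
  refine hM.gm_ind (P := fun _ => False) Dfb.fal (fun g hg ih => ?_) g hg
  obtain ⟨g', hg'⟩ := h g hg
  exact ih g' hg'

include hk hD mono step

theorem exists_done_cut : ∀ r, Gm E W r → ∀ p, LimCut E W p → Cut E W p (pr E (suc E k) r) →
    ∃ q, Cut E W p q ∧ Past E W k q ∧ ∀ r', r' = r ∨ Rl E W r' r → Done r' q := by
  have hks : E k (suc E k) := (mem_suc E).2 (Or.inr rfl)
  have hcut : ∀ {p q q'}, Cut E W p q' → Lex E W q q' → Cut E W p q := fun h h' =>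
    ⟨h'.left, fun hp => hM.lex_trans h' (h.2 hp)⟩
  refine hM.gm_ind ?_ fun r hr ih p hp hrp => ?_
  · refine Dfb.all (Dfb.imp (Dfb.all (Dfb.imp (Dfb.cut hM.mem DT.v1 DT.v0) (Dfb.ex (Dfb.and
      (Dfb.cut hM.mem DT.v2 DT.v0) (Dfb.lex hM.mem DT.v1 DT.v0))))) (Dfb.imp
      (Dfb.cut hM.mem DT.v0 (DT.pr (DT.const _) DT.v1)) (Dfb.ex (Dfb.and
      (Dfb.cut hM.mem DT.v1 DT.v0) (Dfb.and (Dfb.ex (Dfb.lex hM.mem (DT.pr (DT.const _) DT.v0) DT.v1))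
      (Dfb.all (Dfb.imp (Dfb.or (Dfb.eq DT.v0 DT.v3)
        (Dfb.memC hM.mem (DT.pr DT.v0 DT.v3))) (hD DT.v0 DT.v1))))))))
  · have main : ∀ q0, Cut E W p q0 → Past E W k q0 → (∀ r', Rl E W r' r → Done r' q0) →
        ∃ q, Cut E W p q ∧ Past E W k q ∧ ∀ r', r' = r ∨ Rl E W r' r → Done r' q := by
      intro q0 h1 h2 h3
      obtain ⟨q, hq, hc⟩ := hp.exists_chain h1 d
      have hle := hc.le hM
      refine ⟨q, hq, ?_, ?_⟩
      · rcases hle with rfl | hle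
        exacts [h2, h2.mono hM hle]
      · rintro r' (rfl | h')
        · exact step r' q0 q hr h2 h3 hc
        · rcases hle with rfl | hle
          exacts [h3 r' h', mono _ _ _ hle (h3 r' h')]
    by_cases hpred : ∃ r0, Rl E W r0 r ∧ ∀ r', Rl E W r' r → r' = r0 ∨ Rl E W r' r0
    · obtain ⟨r0, hr0, hpred⟩ := hpred
      obtain ⟨q0, h1, h2, h3⟩ := ih r0 hr0 p hp
        (hcut hrp (lex_pr.2 ⟨hk.suc, hk.suc, hr0.left, hr, Or.inr ⟨rfl, hr0⟩⟩))
      exact main q0 h1 h2 fun r' h' => h3 r' (hpred r' h')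
    · push Not at hpred
      refine main _ hrp ⟨r, lex_pr.2 ⟨hk, hk.suc, hr, hr, Or.inl hks⟩⟩ fun r' hr' => ?_
      have hlex : ∀ {r'}, Rl E W r' r → Lex E W (pr E (suc E k) r') (pr E (suc E k) r) :=
        fun h => lex_pr.2 ⟨hk.suc, hk.suc, h.left, hr, Or.inr ⟨rfl, h⟩⟩
      have hself : ∀ {r'}, Rl E W r' r → Cut E W (pr E (suc E k) r) (pr E (suc E k) r') :=
        fun h => ⟨(hlex h).left, fun _ => hlex h⟩
      have hlim : LimCut E W (pr E (suc E k) r) := by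
        rintro q ⟨⟨n, g, hn, hg, rfl⟩, hq⟩
        obtain ⟨-, -, -, -, h | ⟨rfl, h⟩⟩ := lex_pr.1 (hq hrp.1)
        · exact ⟨_, hself hr', lex_pr.2 ⟨hn, hk.suc, hg, hr'.left, Or.inl h⟩⟩
        · obtain ⟨r1, h1, h2, h3⟩ := hpred g h
          refine ⟨_, hself h1, lex_pr.2 ⟨hn, hn, hg, h1.left, Or.inr ⟨rfl, ?_⟩⟩⟩
          rcases hM.rl_total h1.left hg with h | h | h
          exacts [absurd h h2, absurd h h3, h]
      obtain ⟨q, h1, -, h3⟩ := ih r' hr' (pr E (suc E k) r) hlim (hself hr')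
      exact mono _ _ _ (h1.2 hrp.1) (h3 r' (Or.inl rfl))

/-- A recursion along `W` which advances by one point in finitely many stages is decided
before some block. -/
theorem exists_done : ∃ n, Nt E n ∧ ∀ r g, Gm E W r → Gm E W g → Done r (pr E n g) := by
  have key := exists_done_cut hM hk hD mono step
  have hz : ¬ Stg E W (zero E) := by
    rintro ⟨n, g, -, -, h⟩
    exact pr_ne_zero E h.symm
  by_cases hmax : ∃ m, Gm E W m ∧ ∀ r, Gm E W r → r = m ∨ Rl E W r m
  · obtain ⟨m, hm, hmax⟩ := hmax
    obtain ⟨q, ⟨⟨n, g, hn, hg, rfl⟩, -⟩, -, hq⟩ := key m hm (zero E) limCut_zero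
      ⟨⟨_, _, hk.suc, hm, rfl⟩, fun h => absurd h hz⟩
    exact ⟨suc E n, hn.suc, fun r g' hr hg' => mono _ _ _
      (lex_pr.2 ⟨hn, hn.suc, hg, hg', Or.inl ((mem_suc E).2 (Or.inr rfl))⟩) (hq r (hmax r hr))⟩
  · push Not at hmax
    obtain ⟨g0, hg0, hmin⟩ := hM.exists_min
    have hs : E (suc E k) (suc E (suc E k)) := (mem_suc E).2 (Or.inr rfl)
    have hlex : ∀ {g'}, Gm E W g' → ∀ {g}, Gm E W g →
        Lex E W (pr E (suc E k) g) (pr E (suc E (suc E k)) g') :=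
      fun hg' _ hg => lex_pr.2 ⟨hk.suc, hk.suc.suc, hg, hg', Or.inl hs⟩
    have hself : ∀ {g}, Gm E W g → Cut E W (pr E (suc E (suc E k)) g0) (pr E (suc E k) g) :=
      fun hg => ⟨(hlex hg0 hg).left, fun _ => hlex hg0 hg⟩
    refine ⟨suc E (suc E k), hk.suc.suc, fun r g hr hg => ?_⟩
    have hlim : LimCut E W (pr E (suc E (suc E k)) g0) := by
      rintro q ⟨⟨n, g, hn, hg, rfl⟩, hq⟩
      obtain ⟨-, -, -, -, h | ⟨rfl, h⟩⟩ := lex_pr.1 (hq (hlex hg0 hr).right)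
      · obtain ⟨g', hg', h1, h2⟩ := hmax g hg
        refine ⟨_, hself hg', lex_pr.2 ⟨hn, hk.suc, hg, hg', ?_⟩⟩
        rcases (mem_suc E).1 h with h | rfl
        · exact Or.inl h
        · refine Or.inr ⟨rfl, ?_⟩
          rcases hM.rl_total hg' hg with h | h | h
          exacts [absurd h h1, absurd h h2, h]
      · exact absurd h (hmin _)
    obtain ⟨q, h1, -, h3⟩ := key r hr (pr E (suc E (suc E k)) g0) hlim (hself hr)
    have h4 := h1.2 (hlex hg0 hr).right
    have h5 : Lex E W q (pr E (suc E (suc E k)) g) := by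
      obtain ⟨n, g', hn, hg', rfl⟩ := h1.1
      obtain ⟨-, -, -, -, h | ⟨-, h⟩⟩ := lex_pr.1 h4
      exacts [lex_pr.2 ⟨hn, hk.suc.suc, hg', hg, Or.inl h⟩, absurd h (hmin _)]
    exact mono _ _ _ h5 (h3 r (Or.inl rfl))

end Combinatorics

end Decision

end SOST

namespace SOST

section Family

variable {α : Type} {E : α → α → Prop} [hZ : Fact (ZFModel Set.univ E)]
  {𝒳 : Set (Set α)} {W A S : Set α}

variable (E S) in
/-- The classes definable from a bounded part of the recursion. -/
def Fam : Set (Set α) :=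
  {X | ∃ k, Nt E k ∧ Dfb E {lower E S k} fun e : Set α × α => e.2 ∈ X}

theorem Dfb.lower {𝒜 : Set (Set α)} {ρ : Type} [Env α ρ] (hS : S ∈ 𝒜) {x y : ρ → α}
    (hx : DT E 𝒜 x) (hy : DT E 𝒜 y) : Dfb E 𝒜 fun e => x e ∈ SOST.lower E S (y e) := by
  refine Dfb.and (Dfb.memC hS hx) (Dfb.ex (Dfb.ex (Dfb.ex (Dfb.and (Dfb.eq ?_ ?_)
    (Dfb.mem DT.v2 ?_)))))
  exacts [hx.weaken.weaken.weaken, DT.pr (DT.pr DT.v2 DT.v1) DT.v0, hy.weaken.weaken.weaken]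

theorem lower_lower {k k' : α} (hk' : Nt E k') (h : E k k') :
    lower E (lower E S k') k = lower E S k := by
  ext z
  constructor
  · rintro ⟨⟨hz, -⟩, h⟩
    exact ⟨hz, h⟩
  · rintro ⟨hz, n, g, y, rfl, hn⟩
    exact ⟨⟨hz, n, g, y, rfl, hk'.trans hn h⟩, n, g, y, rfl, hn⟩

theorem DefP.lower_mono {k k' : α} (hk' : Nt E k') (h : E k k') {P : (ℕ → α) → Set α → Prop}
    (hP : DefP E {lower E S k} P) : DefP E {lower E S k'} P := by
  refine hP.subst fun B hB i => ?_
  obtain rfl := hB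
  have : Dfb E {lower E S k'} fun e : Set α × α => e.2 ∈ lower E (lower E S k') k :=
    Dfb.lower (Set.mem_singleton _) DT.v0 (DT.const _)
  rw [lower_lower hk' h] at this
  exact this.defP i

theorem lower_mem_fam {k : α} (hk : Nt E k) : lower E S k ∈ Fam E S :=
  ⟨k, hk, Dfb.memC rfl DT.v0⟩

theorem lower_mem (hGB : GBModel Set.univ E 𝒳) [Nonempty α] (hS : S ∈ 𝒳) (k : α) :
    lower E S k ∈ 𝒳 :=
  Dfb.mem_of_gb hGB hS (Set.singleton_subset_iff.2 hS) (Dfb.lower (Set.mem_singleton _) DT.v0 (DT.const k))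

theorem fam_subset (hGB : GBModel Set.univ E 𝒳) [Nonempty α] (hS : S ∈ 𝒳) : Fam E S ⊆ 𝒳 := by
  rintro X ⟨k, hk, hX⟩
  have := lower_mem hGB hS k
  exact Dfb.mem_of_gb hGB this (Set.singleton_subset_iff.2 this) hX

section

variable (hM : RecModel E 𝒳 W)
include hM

theorem DefP.fam {P : (ℕ → α) → Set α → Prop} (hP : DefP E (Fam E S) P) :
    ∃ k, Nt E k ∧ DefP E {SOST.lower E S k} P := by
  have := hM.nonempty
  induction hP with
  | mem i j => exact ⟨_, Nt.zero, .mem i j⟩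
  | eq i j => exact ⟨_, Nt.zero, .eq i j⟩
  | cst i a => exact ⟨_, Nt.zero, .cst i a⟩
  | memC i X hX =>
    obtain ⟨k, hk, hX⟩ := hX
    exact ⟨k, hk, hX.defP i⟩
  | memU i => exact ⟨_, Nt.zero, .memU i⟩
  | fal => exact ⟨_, Nt.zero, .fal⟩
  | imp _ _ ihP ihQ =>
    obtain ⟨k, hk, hP⟩ := ihP
    obtain ⟨k', hk', hQ⟩ := ihQ
    rcases hM.nt_total hk hk' with rfl | h | h
    exacts [⟨k, hk, hP.imp hQ⟩, ⟨k', hk', (hP.lower_mono hk' h).imp hQ⟩,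
      ⟨k, hk, hP.imp (hQ.lower_mono hk h)⟩]
  | all i _ ih =>
    obtain ⟨k, hk, hP⟩ := ih
    exact ⟨k, hk, hP.all i⟩

theorem Dfb.mem_fam {X : Set α} (hX : Dfb E (Fam E S) fun e : Set α × α => e.2 ∈ X) :
    X ∈ Fam E S := by
  obtain ⟨P, hP, h⟩ := hX
  obtain ⟨k, hk, hP⟩ := DefP.fam hM hP
  exact ⟨k, hk, P, hP, h⟩

theorem sat_mem_fam {φ : Fml} (hφ : φ.IsElementary) (𝒴 : Set (Set α)) (s : ℕ → α)
    {c : ℕ → Set α} (hc : ∀ n, c n ∈ Fam E S) :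
    {x | Sat Set.univ E 𝒴 φ (Function.update s 0 x) c} ∈ Fam E S := by
  refine Dfb.mem_fam hM (DefP.dfb (R := fun _ x => x ∈ {x | Sat Set.univ E 𝒴 φ
    (Function.update s 0 x) c}) (Fml.defP (𝒜 := Fam E S) hφ 𝒴 s (c := fun _ => c)
    (fun m i => .memC i _ (hc m)) {0}) fun v U => ?_)
  rw [Set.mem_ofPred_eq]
  have : (fun j => if j ∈ ({0} : Set ℕ) then v j else s j) = Function.update s 0 (v 0) := by
    ext j
    by_cases hj : j = 0
    · subst hj; simp
    · simp [hj]
  rw [this]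

theorem fam_gb (hS : S ∈ 𝒳) : GBModel Set.univ E (Fam E S) where
  classes_sub _ _ := Set.subset_univ _
  zf := hZ.out
  classRepl F hF := have := hM.nonempty; hM.gb.classRepl F (fam_subset hM.gb hS hF)
  elemComp _ hφ s _ _ hc := ⟨_, sat_mem_fam hM hφ _ s hc, fun _ _ => Iff.rfl⟩

theorem fam_coded (hS : S ∈ 𝒳) : ∃ C ∈ 𝒳, CodedBy Set.univ E C (Fam E S) := by
  have := hM.nonempty
  obtain ⟨C, hC, hC'⟩ : ∃ C ∈ 𝒳, ∀ k y, pr E k y ∈ C ↔ Nt E k ∧ y ∈ lower E S k := by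
    refine ⟨{z | ∃ k y, z = pr E k y ∧ Nt E k ∧ y ∈ lower E S k},
      Dfb.mem_of_gb hM.gb hS (Set.singleton_subset_iff.2 hS) ?_, fun k y => ?_⟩
    · exact Dfb.ex (Dfb.ex (Dfb.and (Dfb.eq DT.v2 (DT.pr DT.v1 DT.v0))
        (Dfb.and (Dfb.nt DT.v1) (Dfb.lower (Set.mem_singleton _) DT.v0 DT.v1))))
    · constructor
      · rintro ⟨k', y', h, h'⟩
        obtain ⟨rfl, rfl⟩ := pr_inj.1 h
        exact h'
      · exact fun h => ⟨k, y, rfl, h⟩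
  have hslice : ∀ k, Nt E k → slice Set.univ E C k = lower E S k := fun k hk => by
    ext y
    simp [slice, pairIn_iff, hC', hk]
  refine ⟨C, hC, fun X => ⟨?_, ?_⟩⟩
  · rintro ⟨k, hk, Q, hQ, h⟩
    obtain ⟨L, M, hM, H⟩ := hQ.exists_fml
    obtain ⟨φ, hφ, hφ'⟩ := H (fun i => L.getD i (Classical.arbitrary α)) (fun _ => lower E S k)
      (fun a ha => by
        obtain ⟨i, hi, rfl⟩ := List.mem_iff_getElem.1 ha
        exact ⟨i, by simp [hi]⟩)
      (fun a ha => ⟨0, (hM a ha).symm⟩)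
    refine ⟨φ, hφ, interleave (fun _ => Classical.arbitrary α)
      (fun i => L.getD i (Classical.arbitrary α)), fun _ => trivial, fun _ => k, fun _ => trivial,
      ?_⟩
    ext x
    have := update_interleave (fun _ => Classical.arbitrary α)
      (fun i => L.getD i (Classical.arbitrary α)) 0 x
    rw [mul_zero] at this
    rw [Set.mem_ofPred_eq, this]
    simp only [hslice k hk]
    have h2 := hφ' (Function.update (fun _ => Classical.arbitrary α) 0 x) (lower E S k) (Fam E S)
    simp only [ite_self] at h2
    rw [h2]
    exact (h (lower E S k, x) _ ⟨trivial, Function.update_self _ _ _⟩).symm.trans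
      (and_iff_right trivial).symm
  · rintro ⟨φ, hφ, s, -, g, -, rfl⟩
    have := sat_mem_fam (S := S) hM hφ (Fam E S) s (c := fun n => slice Set.univ E C (g n))
      fun n => ?_
    · simpa using this
    · by_cases hg : Nt E (g n)
      · rw [hslice _ hg]
        exact lower_mem_fam hg
      · have h0 : slice Set.univ E C (g n) = ∅ := by
          ext y
          simp [slice, pairIn_iff, hC', hg]
        rw [h0]
        exact ⟨_, Nt.zero, Dfb.fal⟩

end

end Family

end SOST

namespace SOST

section Recursion

variable {α : Type} {E : α → α → Prop} [hZ : Fact (ZFModel Set.univ E)]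
  {𝒳 : Set (Set α)} {W A S : Set α}

theorem cut_zero {q : α} (hq : Stg E W q) : Cut E W (zero E) q := by
  refine ⟨hq, ?_⟩
  rintro ⟨n, g, -, -, h⟩
  exact absurd h.symm (pr_ne_zero E)

theorem exists_chain {q : α} (hq : Stg E W q) (d : ℕ) : ∃ q', Chain E W d q q' :=
  let ⟨q', _, h⟩ := limCut_zero.exists_chain (cut_zero hq) d
  ⟨q', h⟩

theorem Mk.right {i : ℕ} {q a : α} (h : Mk E W S i q a) : Stg E W q :=
  let ⟨_, h, _⟩ := h
  h.right

variable (E S) in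
/-- `a` is decided positively at some stage. -/
def Tr (a : α) : Prop := ∃ q, pr E q (pr E (tag E 1) a) ∈ S

theorem Mk.tr {q a : α} (h : Mk E W S 1 q a) : Tr E S a :=
  let ⟨q', _, h⟩ := h
  ⟨q', h⟩

theorem Dfb.tr {𝒜 : Set (Set α)} {ρ : Type} [Env α ρ] (hS : S ∈ 𝒜) {x : ρ → α}
    (hx : DT E 𝒜 x) : Dfb E 𝒜 fun e => Tr E S (x e) :=
  Dfb.ex (Dfb.memC hS (DT.pr DT.v0 (DT.pr (DT.const _) hx.weaken)))

variable (E W S) in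
/-- The partial solution below `r` of the recursion along `W` with code `e`, relative to
block `k`. -/
def Hs (k e r : α) : Set α :=
  {z | ∃ r' y, z = pr E r' y ∧ Rl E W r' r ∧ Tr E S (tup E k e r' e (pr E y y))}

variable (E W S) in
/-- The recursion with code `e` is decided at `r` before stage `q`. -/
def Done (k e r q : α) : Prop :=
  ∀ x, Mk E W S 1 q (tup E k e r e (pr E x x)) ∨ Mk E W S 0 q (tup E k e r e (pr E x x))

theorem RecModel.exists_stage (hM : RecModel E 𝒳 W) {k : α} (hk : Nt E k) {e : α}
    (h : ∃ n, Nt E n ∧ ∀ r g, Gm E W r → Gm E W g → Done E W S k e r (pr E n g)) :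
    ∃ q, Past E W k q ∧ ∀ r, Gm E W r → Done E W S k e r q := by
  obtain ⟨n, hn, h⟩ := h
  obtain ⟨g, hg⟩ := hM.exists_gm
  have h1 : Lex E W (pr E k g) (pr E (suc E k) g) :=
    lex_pr.2 ⟨hk, hk.suc, hg, hg, Or.inl ((mem_suc E).2 (Or.inr rfl))⟩
  have h2 := fun r hr => h r g hr hg
  rcases hM.lex_total h1.right ⟨n, g, hn, hg, rfl⟩ with h3 | h3 | h3
  · exact ⟨_, ⟨g, h1⟩, h3 ▸ h2⟩
  · exact ⟨_, ⟨g, hM.lex_trans h1 h3⟩, h2⟩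
  · exact ⟨_, ⟨g, h1⟩, fun r hr x => (h2 r hr x).imp (Sol.mk_mono hM h3) (Sol.mk_mono hM h3)⟩

section

variable (hM : RecModel E 𝒳 W) (hS : Sol E 𝒳 W A S) {k : α}
include hM hS

theorem Sol.tr_consistent {q a : α} (h1 : Tr E S a) (h0 : Mk E W S 0 q a) : False := by
  obtain ⟨q1, h1⟩ := h1
  have hq1 : Stg E W q1 := by
    obtain ⟨q, x, hq, h⟩ := hS.stg _ h1
    exact (pr_inj.1 h).1 ▸ hq
  obtain ⟨q2, m, hm | hm, h2⟩ := exists_chain hq1 1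
  all_goals
    have h3 : Mk E W S 1 q2 a := ⟨q1, by first | exact hm ▸ h2 | exact hM.lex_trans hm h2, h1⟩
    rcases hM.lex_total h0.right h3.right with h | h | h
    · exact hS.consistent hM h3 (h ▸ h0)
    · exact hS.consistent hM h3 (Sol.mk_mono hM h h0)
    · exact hS.consistent hM (Sol.mk_mono hM h h3) h0

theorem Sol.good {e r q0 q : α} (h1 : Past E W k q0)
    (h2 : ∀ r', Rl E W r' r → Done E W S k e r' q0) (hq : Lex E W q0 q) :
    Good E W S k e r (Hs E W S k e r) q := by
  refine ⟨h1.mono hM hq, fun z s => hS.decide hM hq (h1.ready hM hS) (fun hz => ?_)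
    fun hz b hb => ?_⟩
  · by_cases h : ∃ r' y, z = pr E r' y ∧ Rl E W r' r
    · obtain ⟨r', y, rfl, h⟩ := h
      exact ⟨_, (prem_cH hS.hA).2 (Or.inl ⟨r', y, rfl, rfl, h⟩),
        (h2 r' h y).resolve_left fun hm => hz ⟨r', y, rfl, h, hm.tr⟩⟩
    · obtain ⟨g, hg⟩ := h1
      exact ⟨_, (prem_cH hS.hA).2 (Or.inr ⟨rfl, h⟩), _, hg, hS.zero_mem hM hg.left⟩
  · obtain ⟨r', y, rfl, hr, ht⟩ := not_not.1 hz
    rcases (prem_cH hS.hA).1 hb with ⟨r1, y1, h3, rfl, h4⟩ | ⟨-, h3⟩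
    · obtain ⟨rfl, rfl⟩ := pr_inj.1 h3
      exact (h2 r' hr y).resolve_right fun h => hS.tr_consistent hM ht h
    · exact absurd ⟨r', y, rfl, hr⟩ h3

/-- The family satisfies elementary recursion along `W`. -/
theorem Sol.etr_fam (hWF : W ∈ Fam E S) : ETRFor Set.univ E (Fam E S) (relFld Set.univ E W)
    (PairIn Set.univ E W) := by
  intro φ hφ B hB s _
  obtain ⟨k, hk, hP⟩ := DefP.fam hM (Fml.defP (𝒜 := Fam E S) hφ (Fam E S) s
    (c := fun U n => if n = 0 then U else B)
    (fun m i => by by_cases hm : m = 0 <;> simp only [hm, if_true, if_false]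
                   exacts [.memU i, .memC i B hB]) {0})
  obtain ⟨e, d, H⟩ := DefP.rep hM hS hP 1 (fun _ v => v 0) fun _ => IsProj.head
  have hs : ∀ x, (fun j => if j ∈ ({0} : Set ℕ) then x else s j) = Function.update s 0 x := by
    intro x
    ext j
    by_cases hj : j = 0
    · subst hj; simp
    · simp [hj]
  simp only [hs] at H
  have key : ∀ r q0 q, Past E W k q0 → (∀ r', Rl E W r' r → Done E W S k e r' q0) →
      Chain E W (d + 1) q0 q → ∀ x, Correct E W S q (tup E k e r e (pr E x x))
        (Sat Set.univ E (Fam E S) φ (Function.update s 0 x)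
          fun n => if n = 0 then Hs E W S k e r else B) := by
    intro r q0 q h1 h2 h3 x
    obtain ⟨m, hm, h3⟩ := h3.split d hM
    exact H e r _ m q (hS.good hM h1 h2 hm) h3 (fun _ => x) x
  obtain ⟨n, hn, hdone⟩ := exists_done hM hk (Done := Done E W S k e) (d := d + 1)
    (fun hx hy => Dfb.all (Dfb.or
      (Dfb.mk hM.mem hS.memS 1 hy.weaken (DT.pr (DT.pr (DT.const _) (DT.pr (DT.const _) hx.weaken))
        (DT.pr (DT.const _) (DT.pr DT.v0 DT.v0))))
      (Dfb.mk hM.mem hS.memS 0 hy.weaken (DT.pr (DT.pr (DT.const _) (DT.pr (DT.const _) hx.weaken))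
        (DT.pr (DT.const _) (DT.pr DT.v0 DT.v0))))))
    (fun r q q' h h' x => (h' x).imp (Sol.mk_mono hM h) (Sol.mk_mono hM h))
    fun r q0 q _ h1 h2 h3 x => (em _).imp (key r q0 q h1 h2 h3 x).1 (key r q0 q h1 h2 h3 x).2
  obtain ⟨q0, h1, h2⟩ := hM.exists_stage hk ⟨n, hn, hdone⟩
  have hT : ∀ r x, Gm E W r → (Tr E (lower E S (suc E n)) (tup E k e r e (pr E x x)) ↔
      Tr E S (tup E k e r e (pr E x x))) := by
    refine fun r x hr => ⟨fun ⟨q, h⟩ => ⟨q, h.1⟩, fun h => ?_⟩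
    obtain ⟨q, hq, hqS⟩ := (hdone r r hr hr x).resolve_right fun h' => hS.tr_consistent hM h h'
    obtain ⟨m, g, hm, hg, rfl⟩ := hq.left
    refine ⟨_, hqS, m, g, _, rfl, (mem_suc E).2 ?_⟩
    exact (lex_pr.1 hq).2.2.2.2.imp_right fun h => h.1
  refine ⟨{z | ∃ r x, Gm E W r ∧ z = pr E r x ∧
    Tr E (lower E S (suc E n)) (tup E k e r e (pr E x x))}, ?_, ?_, ?_⟩
  · refine Dfb.mem_fam hM (Dfb.ex (Dfb.ex (Dfb.and (Dfb.ex (Dfb.or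
      (Dfb.memC hWF (DT.pr DT.v2 DT.v0)) (Dfb.memC hWF (DT.pr DT.v0 DT.v2))))
      (Dfb.and (Dfb.eq DT.v2 (DT.pr DT.v1 DT.v0)) (Dfb.tr (lower_mem_fam hn.suc)
        (DT.pr (DT.pr (DT.const _) (DT.pr (DT.const _) DT.v1))
          (DT.pr (DT.const _) (DT.pr DT.v0 DT.v0))))))))
  · rintro z ⟨r, x, hr, rfl, -⟩
    exact ⟨r, x, mem_relFld.2 hr, trivial, isKPair_iff.2 rfl⟩
  · intro r hr x _
    rw [mem_relFld] at hr
    obtain ⟨q, hq⟩ : ∃ q, Chain E W (d + 1) q0 q := by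
      obtain ⟨g, hg⟩ := h1
      exact exists_chain hg.right _
    have h3 := key r q0 q h1 (fun r' h => h2 r' h.left) hq x
    have h4 : sliceRestrict Set.univ E {z | ∃ r x, Gm E W r ∧ z = pr E r x ∧
        Tr E (lower E S (suc E n)) (tup E k e r e (pr E x x))} (PairIn Set.univ E W) r =
        Hs E W S k e r := by
      ext z
      simp only [sliceRestrict, isKPair_iff, pairIn_iff, Hs, Set.mem_ofPred_eq]
      constructor
      · rintro ⟨⟨r1, x1, h5, rfl, h6⟩, r2, x2, h7, h8⟩
        obtain ⟨rfl, rfl⟩ := pr_inj.1 h8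
        exact ⟨r1, x1, rfl, h7, (hT r1 x1 h5).1 h6⟩
      · rintro ⟨r1, x1, rfl, h5, h6⟩
        exact ⟨⟨r1, x1, h5.left, rfl, (hT r1 x1 h5.left).2 h6⟩, r1, x1, h5, rfl⟩
    rw [pairIn_iff, h4]
    constructor
    · rintro ⟨r1, x1, -, h5, h6⟩
      obtain ⟨rfl, rfl⟩ := pr_inj.1 h5
      exact by_contra fun h => hS.tr_consistent hM ((hT _ _ hr).1 h6) (h3.2 h)
    · exact fun h => ⟨r, x, hr, rfl, (hT _ _ hr).2 (h3.1 h).tr⟩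

end

end Recursion

end SOST

namespace SOST

section Separation

variable {α : Type} {E : α → α → Prop} [hZ : Fact (ZFModel Set.univ E)]
  {𝒳 𝒴 : Set (Set α)} {W A S S' : Set α}

variable (hM : RecModel E 𝒳 W) (hS : Sol E 𝒳 W A S)
include hM hS

/-- The parameter of the universal recursion is definable from an initial part of it. -/
theorem Sol.mem_fam : A ∈ Fam E S := by
  obtain ⟨g, hg⟩ := hM.exists_gm
  have h1 : E (suc E (zero E)) (suc E (suc E (zero E))) := (mem_suc E).2 (Or.inr rfl)
  have hn : Nt E (suc E (zero E)) := Nt.zero.suc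
  have hlex : Lex E W (pr E (zero E) g) (pr E (suc E (zero E)) g) :=
    lex_pr.2 ⟨Nt.zero, hn, hg, hg, Or.inl ((mem_suc E).2 (Or.inr rfl))⟩
  have key : ∀ z, z ∈ A ↔ pr E (pr E (suc E (zero E)) g) (pr E (tag E 1)
      (tup E (zero E) (zero E) (zero E) (cA E) (pr E z (zero E)))) ∈
        lower E S (suc E (suc E (zero E))) := by
    intro z
    constructor
    · intro hz
      refine ⟨(hS.mark_one hM hlex.right).2 ⟨Past.ready hM hS ⟨g, hlex⟩, _,
        prem_cA.2 ⟨rfl, hz⟩, _, hlex, hS.zero_mem hM hlex.left⟩, _, _, _, rfl, h1⟩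
    · rintro ⟨hz, -⟩
      obtain ⟨-, b, hb, -⟩ := (hS.mark_one hM hlex.right).1 hz
      exact (prem_cA.1 hb).2
  refine ⟨_, hn.suc, Dfb.congr (Dfb.memC (Set.mem_singleton _) (DT.pr (DT.const _)
    (DT.pr (DT.const _) (DT.pr (DT.pr (DT.const _) (DT.pr (DT.const _) (DT.const _)))
      (DT.pr (DT.const _) (DT.pr DT.v0 (DT.const _))))))) fun e => key e.2⟩

theorem Sol.unique (h𝒴 : 𝒴 ⊆ 𝒳) (hS' : Sol E 𝒴 W A S') : S' = S := by
  have key : ∀ q, Stg E W q → ∀ x, pr E q x ∈ S' ↔ pr E q x ∈ S := by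
    refine hM.stg_ind (Dfb.all (Dfb.iff (Dfb.memC (h𝒴 hS'.memS) (DT.pr DT.v1 DT.v0))
      (Dfb.memC hS.memS (DT.pr DT.v1 DT.v0)))) fun q hq ih x => ?_
    have : res E W S' q = res E W S q := by
      ext z
      constructor
      · rintro ⟨hz, r, x, h, rfl⟩
        exact ⟨(ih r h x).1 hz, r, x, h, rfl⟩
      · rintro ⟨hz, r, x, h, rfl⟩
        exact ⟨(ih r h x).2 hz, r, x, h, rfl⟩
    rw [hS.spec q hq, hS'.spec q hq, this]
  ext z
  constructor
  · intro hz
    obtain ⟨q, x, hq, rfl⟩ := hS'.stg z hz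
    exact (key q hq x).1 hz
  · intro hz
    obtain ⟨q, x, hq, rfl⟩ := hS.stg z hz
    exact (key q hq x).2 hz

/-- The universal recursion is not definable from an initial part of it. -/
theorem Sol.not_mem_fam : S ∉ Fam E S := by
  rintro ⟨k, hk, hSk⟩
  obtain ⟨r, hr, hmin⟩ := hM.exists_min
  have hX : Dfb E {S} fun e : Set α × α =>
      e.2 ∈ {x | ¬ Tr E S (tup E k (zero E) r x (pr E x (zero E)))} :=
    Dfb.not (Dfb.tr (Set.mem_singleton _) (DT.pr (DT.pr (DT.const _) (DT.pr (DT.const _)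
      (DT.const _))) (DT.pr DT.v0 (DT.pr DT.v0 (DT.const _)))))
  have hX' := hX.subst (ℬ := {lower E S k}) fun B hB i => by
    obtain rfl := hB
    exact hSk.defP i
  obtain ⟨t, d, H⟩ := DefP.rep hM hS (hX'.defP 0) 1 (fun _ v => v 0) fun _ => IsProj.head
  have hlex : Lex E W (pr E k r) (pr E (suc E k) r) :=
    lex_pr.2 ⟨hk, hk.suc, hr, hr, Or.inl ((mem_suc E).2 (Or.inr rfl))⟩
  obtain ⟨q, hq⟩ := exists_chain hlex.right (d + 1)
  obtain ⟨m, hm, hq⟩ := hq.split d hM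
  have h := H (zero E) r _ m q (hS.good hM ⟨r, hlex⟩ (fun r' h => absurd h (hmin r')) hm) hq
    (fun _ => t) (zero E)
  by_cases ht : Tr E S (tup E k (zero E) r t (pr E t (zero E)))
  · exact hS.tr_consistent hM ht (h.2 fun h => h ht)
  · exact ht (h.1 ht).tr

theorem Sol.not_etr_fam (hWF : W ∈ Fam E S) : ¬ ETRFor Set.univ E (Fam E S)
    (timesOmegaFld Set.univ E (relFld Set.univ E W))
    (timesOmegaLt Set.univ E (relFld Set.univ E W) (PairIn Set.univ E W)) := by
  intro h
  have := hM.nonempty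
  have hM' : RecModel E (Fam E S) W := ⟨fam_gb hM hS.memS, hWF, hM.wo, hM.ne, h⟩
  obtain ⟨S', hS'⟩ := hM'.exists_sol hS.hA (hS.mem_fam hM)
  have := hS.unique hM (fam_subset hM.gb hS.memS) hS'
  exact hS.not_mem_fam hM (this ▸ hS'.memS)

end Separation

/-- There is a universal recursion with a parameter coding `W` and a given class. -/
theorem RecModel.exists_sol_coding {α : Type} {E : α → α → Prop} [Fact (ZFModel Set.univ E)]
    {𝒳 : Set (Set α)} {W F : Set α} (hM : RecModel E 𝒳 W) (hF : F ∈ 𝒳) :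
    ∃ A S, Sol E 𝒳 W A S ∧ W ∈ Fam E S ∧ F ∈ Fam E S := by
  have := hM.nonempty
  have hA : {z | (∃ x, z = pr E (tag E 0) x ∧ x ∈ W) ∨ ∃ x, z = pr E (tag E 1) x ∧ x ∈ F} ∈ 𝒳 := by
    refine Dfb.mem_of_gb (𝒜 := {W, F}) hM.gb hF ?_ (Dfb.or
      (Dfb.ex (Dfb.and (Dfb.eq DT.v1 (DT.pr (DT.const _) DT.v0)) (Dfb.memC ?_ DT.v0)))
      (Dfb.ex (Dfb.and (Dfb.eq DT.v1 (DT.pr (DT.const _) DT.v0)) (Dfb.memC ?_ DT.v0))))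
    · rintro X (rfl | rfl)
      exacts [hM.mem, hF]
    · exact Or.inl rfl
    · exact Or.inr rfl
  obtain ⟨S, hS⟩ := hM.exists_sol (fun x => by simp [pr_inj, tag_inj]) hA
  refine ⟨_, S, hS, Dfb.mem_fam hM ?_, Dfb.mem_fam hM ?_⟩
  · exact (Dfb.memC (hS.mem_fam hM) (DT.pr (DT.const (tag E 0)) DT.v0)).congr fun e => by
      simp [pr_inj, tag_inj]
  · exact (Dfb.memC (hS.mem_fam hM) (DT.pr (DT.const (tag E 1)) DT.v0)).congr fun e => by
      simp [pr_inj, tag_inj]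

end SOST

namespace SOST

/-- If `(M, 𝒳) ⊨ GB` and `Γ ∈ 𝒳` is a class well-order `≥ ω^ω` with
`(M, 𝒳) ⊨ ETR_{Γ·ω}`, then there is `𝒴 ⊆ 𝒳`, coded by a single class in `𝒳`, with
`(M, 𝒴) ⊨ GB + ETR_Γ` but `(M, 𝒴) ⊭ ETR_{Γ·ω}`; and `𝒴` can preserve Global Choice. -/
theorem separate_ETR_Gamma_omega {α : Type} (E : α → α → Prop) (𝒳 : Set (Set α))
    (hGB : GBModel (Set.univ : Set α) E 𝒳)
    (W : Set α) (hW : W ∈ 𝒳) (hwo : IsClassWO Set.univ E W)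
    (hbig : GeOmegaPowOmega (relFld Set.univ E W) (PairIn Set.univ E W))
    (hetr : ETRFor Set.univ E 𝒳
      (timesOmegaFld Set.univ E (relFld Set.univ E W))
      (timesOmegaLt Set.univ E (relFld Set.univ E W) (PairIn Set.univ E W))) :
    ∃ 𝒴 : Set (Set α), 𝒴 ⊆ 𝒳 ∧ (∃ C ∈ 𝒳, CodedBy Set.univ E C 𝒴) ∧
      GBModel Set.univ E 𝒴 ∧
      ETRFor Set.univ E 𝒴 (relFld Set.univ E W) (PairIn Set.univ E W) ∧
      ¬ ETRFor Set.univ E 𝒴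
        (timesOmegaFld Set.univ E (relFld Set.univ E W))
        (timesOmegaLt Set.univ E (relFld Set.univ E W) (PairIn Set.univ E W)) ∧
      (GlobalChoice Set.univ E 𝒳 → GlobalChoice Set.univ E 𝒴) := by
  have hZ : Fact (ZFModel Set.univ E) := ⟨hGB.zf⟩
  have hne : (relFld Set.univ E W).Nonempty := by
    obtain ⟨f, hf, -⟩ := hbig 0
    exact ⟨_, hf 0⟩
  have hM : RecModel E 𝒳 W := ⟨hGB, hW, hwo, hne, hetr⟩
  have := hM.nonempty
  obtain ⟨F, hF, hF'⟩ : ∃ F ∈ 𝒳, GlobalChoice Set.univ E 𝒳 → GlobalChoice Set.univ E {F} := by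
    by_cases h : GlobalChoice Set.univ E 𝒳
    · obtain ⟨F, hF, hF'⟩ := h
      exact ⟨F, hF, fun _ => ⟨F, rfl, hF'⟩⟩
    · exact ⟨W, hW, fun h' => absurd h' h⟩
  obtain ⟨A, S, hS, hWF, hFF⟩ := hM.exists_sol_coding hF
  refine ⟨Fam E S, fam_subset hGB hS.memS, fam_coded hM hS.memS, fam_gb hM hS.memS,
    hS.etr_fam hM hWF, hS.not_etr_fam hM hWF, fun h => ?_⟩
  obtain ⟨F', rfl, h'⟩ := hF' h
  exact ⟨F', hFF, h'⟩

end SOST
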